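/- Let f : ℝⁿ → ℝ ∪ {+∞} be a proper lower semicontinuous function that is both prox-regular and subdifferentially continuous at x̄ for x̄* = 0 ∈ ∂f(x̄). (1) If x̄ is a tilt-stable local minimizer of f with modulus κ > 0, then for every r ∈ [0, κ⁻¹) and every u ∈ ℝⁿ one has κ‖u*‖ ≥ ‖u‖ and ⟨u*, u⟩ ≥ −r‖u‖² whenever u* ∈ ∂²f(x̄, 0)(u). (2) Conversely, if there exist μ > 0 and r ∈ [0, μ⁻¹) such that for every u ∈ ℝⁿ one has μ‖u*‖ ≥ ‖u‖ and ⟨u*, u⟩ ≥ −r‖u‖² whenever u* ∈ ∂²f(x̄, 0)(u), then x̄ is a tilt-stable local minimizer of f with any modulus κ > μ. -/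

import Mathlib

open Filter Metric Topology RealInnerProductSpace

noncomputable section

variable {X : Type*} [NormedAddCommGroup X] [InnerProductSpace ℝ X]

/-- The regular/Fréchet subdifferential of `f` at `x`. -/
def FrechetSubdiff (f : X → EReal) (x : X) : Set X :=
  {p | f x ≠ ⊤ ∧ ∀ ε : ℝ, 0 < ε → ∃ δ : ℝ, 0 < δ ∧
    ∀ y : X, ‖y - x‖ < δ → f x + ((⟪p, y - x⟫ - ε * ‖y - x‖ : ℝ) : EReal) ≤ f y}

/-- The limiting subdifferential of `f` at `x`: outer limit (in norm) of
Fréchet subdifferentials. -/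
def LimitingSubdiff (f : X → EReal) (x : X) : Set X :=
  {p | ∃ (xs ps : ℕ → X),
    (∀ k, ps k ∈ FrechetSubdiff f (xs k)) ∧
    Tendsto xs atTop (𝓝 x) ∧
    Tendsto (fun k => f (xs k)) atTop (𝓝 (f x)) ∧
    Tendsto ps atTop (𝓝 p)}

/-- `f` is subdifferentially continuous at `xb` for `pb`: the map `(x, p) ↦ f x` is
continuous at `(xb, pb)` relative to the graph of the limiting subdifferential. -/
def SubdiffContAt (f : X → EReal) (xb pb : X) : Prop :=
  Tendsto (fun q : X × X => f q.1)
    (𝓝[{q : X × X | q.2 ∈ LimitingSubdiff f q.1}] (xb, pb)) (𝓝 (f xb))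

/-- `f` is prox-regular at `xb` for `pb`. -/
def ProxRegularAt (f : X → EReal) (xb pb : X) : Prop :=
  f xb ≠ ⊤ ∧ ∃ r : ℝ, 0 < r ∧ ∃ ε : ℝ, 0 < ε ∧
    ∀ x ∈ Metric.closedBall xb ε, ∀ u ∈ Metric.closedBall xb ε,
      f u ≤ f xb + (ε : EReal) → f xb ≤ f u + (ε : EReal) →
      ∀ p ∈ LimitingSubdiff f u, p ∈ Metric.closedBall pb ε →
        f u + ((⟪p, x - u⟫ - r / 2 * ‖x - u‖ ^ 2 : ℝ) : EReal) ≤ f x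

/-- The set of minimizers of the tilted function `x ↦ f x - ⟪p, x⟫` over the
closed ball of radius `γ` around `xb`. -/
def TiltArgmin (f : X → EReal) (xb : X) (γ : ℝ) (p : X) : Set X :=
  {x | x ∈ Metric.closedBall xb γ ∧ ∀ y ∈ Metric.closedBall xb γ,
    f x - ((⟪p, x⟫ : ℝ) : EReal) ≤ f y - ((⟪p, y⟫ : ℝ) : EReal)}

/-- `xb` is a tilt-stable local minimizer of `f` with modulus `κ`. -/
def TiltStableWith (f : X → EReal) (xb : X) (κ : ℝ) : Prop :=
  ∃ γ : ℝ, 0 < γ ∧ ∃ V ∈ 𝓝 (0 : X), ∃ m : X → X,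
    (∀ p ∈ V, TiltArgmin f xb γ p = {m p}) ∧
    LipschitzOnWith (Real.toNNReal κ) m V ∧ m 0 = xb

/-- `xb` is a tilt-stable local minimizer of `f`. -/
def TiltStable (f : X → EReal) (xb : X) : Prop :=
  ∃ γ : ℝ, 0 < γ ∧ ∃ V ∈ 𝓝 (0 : X), ∃ m : X → X, ∃ K : NNReal,
    (∀ p ∈ V, TiltArgmin f xb γ p = {m p}) ∧
    LipschitzOnWith K m V ∧ m 0 = xb

/-- The Fréchet/regular normal cone to a subset of `X × X` at a point. -/
def FrechetNormalP (Ω : Set (X × X)) (zb : X × X) : Set (X × X) :=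
  {w | ∀ ε : ℝ, 0 < ε → ∃ δ : ℝ, 0 < δ ∧ ∀ z ∈ Ω, dist z zb < δ →
    ⟪w.1, z.1 - zb.1⟫ + ⟪w.2, z.2 - zb.2⟫ ≤ ε * dist z zb}

/-- The combined second-order subdifferential of `f` at `x` for `p ∈ ∂f(x)`:
the regular coderivative of the limiting subdifferential mapping. -/
def CombinedSecondSubdiff (f : X → EReal) (x p u : X) : Set X :=
  {w | (w, -u) ∈ FrechetNormalP {q : X × X | q.2 ∈ LimitingSubdiff f q.1} (x, p)}

/-- The limiting/Mordukhovich normal cone to a subset of `X × X` at a point. -/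
def LimitingNormalP (Ω : Set (X × X)) (zb : X × X) : Set (X × X) :=
  {w | ∃ (zs ws : ℕ → X × X),
    (∀ k, zs k ∈ Ω ∧ ws k ∈ FrechetNormalP Ω (zs k)) ∧
    Tendsto zs atTop (𝓝 zb) ∧ Tendsto ws atTop (𝓝 w)}

/-- The second-order subdifferential (generalized Hessian) of `f` at `xb` for
`pb ∈ ∂f(xb)`: the limiting coderivative of the limiting subdifferential mapping. -/
def SecondSubdiff (f : X → EReal) (xb pb u : X) : Set X :=
  {w | (w, -u) ∈ LimitingNormalP {q : X × X | q.2 ∈ LimitingSubdiff f q.1} (xb, pb)}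

open MeasureTheory in
lemma line_lower (g : ℝ → ℝ) (K : NNReal) (hL : LipschitzOnWith K g (Set.uIcc 0 1)) (C : ℝ)
    (h : ∀ᵐ t : ℝ, t ∈ Set.Icc (0 : ℝ) 1 → C ≤ deriv g t) : C ≤ g 1 - g 0 := by
  have hac := hL.absolutelyContinuousOnInterval
  rw [← hac.integral_deriv_eq_sub]
  have hi := hac.intervalIntegrable_deriv
  have h1 : ∫ t in (0 : ℝ)..1, C = C := by simp
  rw [← h1]
  apply intervalIntegral.integral_mono_ae_restrict zero_le_one (by simp) hi
  rw [Filter.EventuallyLE, ae_restrict_iff' measurableSet_Icc]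
  exact h

open MeasureTheory in
lemma integrate_ineq {n : ℕ} (P : EuclideanSpace ℝ (Fin n) → EuclideanSpace ℝ (Fin n))
    (c : EuclideanSpace ℝ (Fin n)) (b a : ℝ) (K : NNReal) (ha : 0 < a)
    (hL : LipschitzOnWith K P (ball c b))
    (hD : ∀ z ∈ ball c b, DifferentiableAt ℝ P z → ∀ v,
      a * ‖fderiv ℝ P z v‖ ^ 2 ≤ ⟪fderiv ℝ P z v, v⟫)
    (z z' : EuclideanSpace ℝ (Fin n)) (hz : z ∈ ball c b) (hz' : z' ∈ ball c b) :
    a * ‖P z' - P z‖ ^ 2 ≤ ⟪P z' - P z, z' - z⟫ := by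
  set v := z' - z with hv
  have hae : ∀ᵐ x : EuclideanSpace ℝ (Fin n), x ∈ ball c b → DifferentiableAt ℝ P x := by
    filter_upwards [hL.ae_differentiableWithinAt_of_mem (μ := volume)] with x hx hxb
    exact (hx hxb).differentiableAt (isOpen_ball.mem_nhds hxb)
  have hms : MeasurableSet {x : EuclideanSpace ℝ (Fin n) |
      x ∈ ball c b → DifferentiableAt ℝ P x} := by
    have h1 : MeasurableSet {x : EuclideanSpace ℝ (Fin n) | DifferentiableAt ℝ P x} :=
      measurableSet_of_differentiableAt ℝ P
    have h2 : MeasurableSet (ball c b) := measurableSet_ball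
    have : {x : EuclideanSpace ℝ (Fin n) | x ∈ ball c b → DifferentiableAt ℝ P x}
      = (ball c b)ᶜ ∪ {x | DifferentiableAt ℝ P x} := by
      ext x; simp only [Set.mem_ofPred_eq, Set.mem_union, Set.mem_compl_iff]; tauto
    rw [this]; exact h2.compl.union h1
  have hae2 : ∀ᵐ e : EuclideanSpace ℝ (Fin n), ∀ᵐ t : ℝ,
      (z + t • v) + e ∈ ball c b → DifferentiableAt ℝ P ((z + t • v) + e) := by
    rw [Measure.ae_ae_comm]
    · filter_upwards with t
      have := (measurePreserving_add_left (volume : Measure (EuclideanSpace ℝ (Fin n)))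
        (z + t • v)).quasiMeasurePreserving.ae hae
      exact this
    · have hc : Measurable (fun q : EuclideanSpace ℝ (Fin n) × ℝ => (z + q.2 • v) + q.1) := by
        fun_prop
      exact hc hms
  have key : ∀ᵐ e : EuclideanSpace ℝ (Fin n), z + e ∈ ball c b → z' + e ∈ ball c b →
      a * ‖P (z' + e) - P (z + e)‖ ^ 2 ≤ ⟪P (z' + e) - P (z + e), v⟫ := by
    filter_upwards [hae2] with e he h1 h2
    set q := P (z' + e) - P (z + e) with hq
    set g : ℝ → ℝ := fun t => ⟪P ((z + t • v) + e), v - (2 * a) • q⟫ with hg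
    have hseg : ∀ t ∈ Set.Icc (0 : ℝ) 1, (z + t • v) + e ∈ ball c b := by
      intro t ht
      have := (convex_ball c b).add_smul_sub_mem h1 h2 ht
      convert this using 1
      rw [hv]; simp; abel
    have hgL : LipschitzOnWith (K * ‖v‖₊ * ‖v - (2 * a) • q‖₊) g (Set.uIcc 0 1) := by
      rw [Set.uIcc_of_le zero_le_one]
      apply LipschitzOnWith.of_dist_le_mul
      intro s hs t ht
      have h3 := hL.dist_le_mul _ (hseg s hs) _ (hseg t ht)
      rw [Real.dist_eq, hg]
      simp only
      rw [← inner_sub_left]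
      refine (abs_real_inner_le_norm _ _).trans ?_
      rw [dist_eq_norm] at h3
      have h4 : dist (z + s • v + e) (z + t • v + e) = dist s t * ‖v‖ := by
        rw [dist_eq_norm, Real.dist_eq, ← Real.norm_eq_abs, ← norm_smul]
        congr 1; rw [sub_smul]; abel
      rw [h4] at h3
      push_cast
      calc _ ≤ (K * (dist s t * ‖v‖)) * ‖v - (2 * a) • q‖ := by gcongr
        _ = _ := by ring
    have hder : ∀ᵐ t : ℝ, t ∈ Set.Icc (0 : ℝ) 1 → -(a * ‖q‖ ^ 2) ≤ deriv g t := by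
      filter_upwards [he] with t ht htI
      have hmem := hseg t htI
      have hd := ht hmem
      have hline : HasDerivAt (fun t : ℝ => (z + t • v) + e) v t := by
        have := (((hasDerivAt_id t).smul_const v).const_add z).add_const e
        simpa using this
      have hd2 : HasDerivAt (fun t : ℝ => P ((z + t • v) + e))
          (fderiv ℝ P ((z + t • v) + e) v) t :=
        HasFDerivAt.comp_hasDerivAt t hd.hasFDerivAt hline
      have hd3 : HasDerivAt g (⟪fderiv ℝ P ((z + t • v) + e) v, v - (2 * a) • q⟫) t := by
        have := hd2.inner ℝ (hasDerivAt_const t (v - (2 * a) • q))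
        simpa using this
      rw [hd3.deriv]
      have h5 := hD _ hmem hd v
      set y := fderiv ℝ P ((z + t • v) + e) v
      rw [inner_sub_right, inner_smul_right]
      have h6 : 0 ≤ ‖y - q‖ ^ 2 := by positivity
      rw [norm_sub_sq_real] at h6
      nlinarith
    have h7 := line_lower g _ hgL _ hder
    have h8 : g 1 - g 0 = ⟪q, v⟫ - 2 * a * ‖q‖ ^ 2 := by
      simp only [hg]
      rw [← inner_sub_left, one_smul, zero_smul, add_zero]
      have : z + v = z' := by rw [hv]; abel
      rw [this, ← hq, inner_sub_right, inner_smul_right, real_inner_self_eq_norm_sq]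
    rw [h8] at h7
    linarith
  have hfr : ∃ᶠ e in 𝓝 (0 : EuclideanSpace ℝ (Fin n)), z + e ∈ ball c b → z' + e ∈ ball c b →
      a * ‖P (z' + e) - P (z + e)‖ ^ 2 ≤ ⟪P (z' + e) - P (z + e), v⟫ := by
    have hdense := Measure.dense_of_ae key
    exact mem_closure_iff_frequently.1 (hdense 0)
  have hcz : ∀ y ∈ ball c b, Tendsto (fun e => P (y + e)) (𝓝 0) (𝓝 (P y)) := by
    intro y hy
    have h1 : ContinuousAt P y := hL.continuousOn.continuousAt (isOpen_ball.mem_nhds hy)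
    have h2 : Tendsto (fun e => y + e) (𝓝 0) (𝓝 y) := by
      have : Continuous (fun e => y + e) := by fun_prop
      simpa using this.tendsto 0
    exact h1.tendsto.comp h2
  have hev : ∀ y ∈ ball c b, ∀ᶠ e in 𝓝 0, y + e ∈ ball c b := by
    intro y hy
    have h2 : Tendsto (fun e => y + e) (𝓝 0) (𝓝 y) := by
      have : Continuous (fun e => y + e) := by fun_prop
      simpa using this.tendsto 0
    exact h2.eventually (isOpen_ball.mem_nhds hy)
  have hT1 : Tendsto (fun e => ⟪P (z' + e) - P (z + e), v⟫ - a * ‖P (z' + e) - P (z + e)‖ ^ 2)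
      (𝓝 0) (𝓝 (⟪P z' - P z, v⟫ - a * ‖P z' - P z‖ ^ 2)) := by
    have h1 := (hcz z' hz').sub (hcz z hz)
    exact (h1.inner tendsto_const_nhds).sub ((h1.norm.pow 2).const_mul a)
  have := ge_of_tendsto_of_frequently hT1 (b := 0)
    ((hfr.and_eventually ((hev z hz).and (hev z' hz'))).mono (by
      rintro e ⟨h1, h2, h3⟩
      have := h1 h2 h3
      linarith))
  linarith
lemma sym_ineq {n : ℕ} (A : EuclideanSpace ℝ (Fin n) →L[ℝ] EuclideanSpace ℝ (Fin n))
    (hs : ∀ v w, ⟪A v, w⟫ = ⟪v, A w⟫) (a : ℝ)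
    (h : ∀ (α : ℝ) v, ‖v‖ = 1 → A v = α • v → a * α ^ 2 ≤ α) (v : EuclideanSpace ℝ (Fin n)) :
    a * ‖A v‖ ^ 2 ≤ ⟪A v, v⟫ := by
  have hS : (A : EuclideanSpace ℝ (Fin n) →ₗ[ℝ] EuclideanSpace ℝ (Fin n)).IsSymmetric := by
    intro x y; exact hs x y
  set b := hS.eigenvectorBasis (n := n) (by simp) with hb
  set e := hS.eigenvalues (n := n) (by simp) with he
  have hbe : ∀ i, A (b i) = e i • b i := by
    intro i
    have := hS.apply_eigenvectorBasis (n := n) (by simp) i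
    exact this
  have hco : ∀ i, ⟪A v, b i⟫ = e i * ⟪v, b i⟫ := by
    intro i; rw [hs, hbe, inner_smul_right]
  rw [← real_inner_self_eq_norm_sq, ← b.sum_inner_mul_inner, ← b.sum_inner_mul_inner,
    Finset.mul_sum]
  apply Finset.sum_le_sum
  intro i _
  rw [real_inner_comm v (b i), real_inner_comm (A v) (b i), hco]
  have := h (e i) (b i) (b.orthonormal.1 i) (hbe i)
  nlinarith [mul_le_mul_of_nonneg_right this (sq_nonneg (⟪v, b i⟫))]

lemma surj_S {E : Type*} [NormedAddCommGroup E] [InnerProductSpace ℝ E] [CompleteSpace E]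
    (m : E → E) (κ : ℝ) (p0 : E) (η : ℝ) (hη : 0 < η)
    (hLip : ∀ p ∈ closedBall p0 η, ∀ p' ∈ closedBall p0 η, ‖m p - m p'‖ ≤ κ * ‖p - p'‖)
    (hmono : ∀ p ∈ closedBall p0 η, ∀ p' ∈ closedBall p0 η, 0 ≤ ⟪p - p', m p - m p'⟫)
    (lam : ℝ) (hl : 0 < lam) :
    ∃ β > 0, ∀ z, ‖z - (m p0 + lam • p0)‖ ≤ β →
      ∃ p ∈ closedBall p0 η, m p + lam • p = z := by
  have hpos : 0 < lam ^ 2 + κ ^ 2 := by positivity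
  set τ := lam / (lam ^ 2 + κ ^ 2) with hτ
  have hτ0 : 0 < τ := by positivity
  have hτe : τ * (lam ^ 2 + κ ^ 2) = lam := by rw [hτ]; field_simp
  have hτl : τ * lam ≤ 1 := by
    rw [hτ, div_mul_eq_mul_div, div_le_one hpos]; nlinarith [sq_nonneg κ]
  set q := Real.sqrt (1 - τ * lam) with hq
  have hq0 : 0 ≤ q := Real.sqrt_nonneg _
  have hq2 : q ^ 2 = 1 - τ * lam := Real.sq_sqrt (by linarith)
  have hq1 : q < 1 := by
    have : 0 < τ * lam := by positivity
    nlinarith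
  have hcon : ∀ z, ∀ p ∈ closedBall p0 η, ∀ p' ∈ closedBall p0 η,
      ‖(p - τ • (m p + lam • p - z)) - (p' - τ • (m p' + lam • p' - z))‖ ≤ q * ‖p - p'‖ := by
    intro z p hp p' hp'
    have e1 : (p - τ • (m p + lam • p - z)) - (p' - τ • (m p' + lam • p' - z))
        = (1 - τ * lam) • (p - p') - τ • (m p - m p') := by
      module
    rw [e1]
    apply le_of_sq_le_sq _ (by positivity)
    rw [norm_sub_sq_real, norm_smul, norm_smul, inner_smul_left, inner_smul_right, mul_pow, mul_pow,
      mul_pow, hq2]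
    simp only [Real.norm_eq_abs, sq_abs, conj_trivial]
    have h1 := hLip p hp p' hp'
    have h2 := hmono p hp p' hp'
    have h3 : ‖m p - m p'‖ ^ 2 ≤ κ ^ 2 * ‖p - p'‖ ^ 2 := by
      rw [← mul_pow]; exact pow_le_pow_left₀ (norm_nonneg _) h1 2
    have h4 : 0 ≤ (1 - τ * lam) * (τ * ⟪p - p', m p - m p'⟫) :=
      mul_nonneg (by linarith) (by positivity)
    have h5 : τ ^ 2 * ‖m p - m p'‖ ^ 2 ≤ τ ^ 2 * (κ ^ 2 * ‖p - p'‖ ^ 2) := by gcongr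
    have h6 : (1 - τ * lam) ^ 2 + τ ^ 2 * κ ^ 2 = 1 - τ * lam := by
      have : τ ^ 2 * (lam ^ 2 + κ ^ 2) = τ * lam := by rw [sq, mul_assoc, hτe]
      linarith
    have h7 : (1 - τ * lam) ^ 2 * ‖p - p'‖ ^ 2 + τ ^ 2 * (κ ^ 2 * ‖p - p'‖ ^ 2)
        = (1 - τ * lam) * ‖p - p'‖ ^ 2 := by
      linear_combination ‖p - p'‖ ^ 2 * h6
    linarith
  refine ⟨(1 - q) * η / τ, by have : 0 < 1 - q := by linarith
                              positivity, ?_⟩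
  intro z hz
  have hp0 : p0 ∈ closedBall p0 η := mem_closedBall_self hη.le
  have hmaps : Set.MapsTo (fun p => p - τ • (m p + lam • p - z)) (closedBall p0 η)
      (closedBall p0 η) := by
    intro p hp
    rw [mem_closedBall, dist_eq_norm]
    have h1 := hcon z p hp p0 hp0
    have e1 : (p - τ • (m p + lam • p - z)) - p0 =
      ((p - τ • (m p + lam • p - z)) - (p0 - τ • (m p0 + lam • p0 - z)))
        + τ • (z - (m p0 + lam • p0)) := by module
    show ‖(p - τ • (m p + lam • p - z)) - p0‖ ≤ η
    rw [e1]
    refine (norm_add_le _ _).trans ?_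
    rw [norm_smul, Real.norm_of_nonneg hτ0.le]
    have h2 : ‖p - p0‖ ≤ η := by rwa [mem_closedBall, dist_eq_norm] at hp
    have h3 : τ * ‖z - (m p0 + lam • p0)‖ ≤ (1 - q) * η := by
      rw [le_div_iff₀ hτ0] at hz; linarith
    have h4 : q * ‖p - p0‖ ≤ q * η := by gcongr
    linarith
  have hcw : ContractingWith (⟨q, hq0⟩ : NNReal)
      (hmaps.restrict (fun p => p - τ • (m p + lam • p - z)) _ _) := by
    refine ⟨by exact_mod_cast hq1, LipschitzWith.of_dist_le_mul ?_⟩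
    rintro ⟨p, hp⟩ ⟨p', hp'⟩
    have := hcon z p hp p' hp'
    rw [Subtype.dist_eq, Subtype.dist_eq, dist_eq_norm, dist_eq_norm]
    exact this
  obtain ⟨y, hy, hfix, -⟩ := hcw.exists_fixedPoint' isClosed_closedBall.isComplete hmaps hp0
    (edist_ne_top _ _)
  refine ⟨y, hy, ?_⟩
  have h1 : y - τ • (m y + lam • y - z) = y := hfix
  have h2 : τ • (m y + lam • y - z) = 0 := by
    rwa [sub_eq_self] at h1
  rcases smul_eq_zero.1 h2 with h3 | h3
  · exact absurd h3 hτ0.ne'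
  · exact sub_eq_zero.1 h3

/-- Localized prox-regularity inequality on the graph of the limiting subdifferential. -/
def LocPR (f : X → EReal) (xb : X) (ρ ε : ℝ) : Prop :=
  0 < ρ ∧ 0 < ε ∧ ∀ u p, p ∈ LimitingSubdiff f u → ‖u - xb‖ ≤ ε → ‖p‖ ≤ ε →
    f u ≠ ⊤ ∧ ∀ x, ‖x - xb‖ ≤ ε → f u + ((⟪p, x - u⟫ - ρ / 2 * ‖x - u‖ ^ 2 : ℝ) : EReal) ≤ f x

lemma locPR_of (f : X → EReal) (xb : X) (hbot : ∀ x, f x ≠ ⊥)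
    (hpr : ProxRegularAt f xb 0) (hsc : SubdiffContAt f xb 0) : ∃ ρ ε, LocPR f xb ρ ε := by
  obtain ⟨hfin, ρ, hρ, ε, hε, H⟩ := hpr
  obtain ⟨a, ha⟩ : ∃ a : ℝ, f xb = a := ⟨(f xb).toReal, (EReal.coe_toReal hfin (hbot _)).symm⟩
  have hN : Set.Ioo (((a - ε : ℝ) : EReal)) (((a + ε : ℝ) : EReal)) ∈ 𝓝 (f xb) := by
    apply Ioo_mem_nhds
    · rw [ha]; exact_mod_cast (by linarith : a - ε < a)
    · rw [ha]; exact_mod_cast (by linarith : a < a + ε)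
  have h1 := hsc hN
  rw [mem_map, mem_nhdsWithin_iff] at h1
  obtain ⟨δ, hδ, h1⟩ := h1
  refine ⟨ρ, min ε (δ / 2), hρ, by positivity, ?_⟩
  intro u p hp hu hpn
  have h2 : (u, p) ∈ (fun q : X × X => f q.1) ⁻¹'
      Set.Ioo (((a - ε : ℝ) : EReal)) (((a + ε : ℝ) : EReal)) := by
    apply h1
    refine ⟨?_, hp⟩
    rw [mem_ball, Prod.dist_eq, max_lt_iff, dist_eq_norm, dist_eq_norm, sub_zero]
    have := min_le_right ε (δ / 2)
    constructor <;> simp only <;> linarith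
  obtain ⟨h3, h4⟩ := h2
  simp only at h3 h4
  have h5 : f u ≠ ⊤ := fun h => by rw [h] at h4; exact not_top_lt h4
  refine ⟨h5, ?_⟩
  obtain ⟨c, hc⟩ : ∃ c : ℝ, f u = c := ⟨(f u).toReal, (EReal.coe_toReal h5 (hbot _)).symm⟩
  rw [hc] at h3 h4
  have h3' : a - ε < c := by exact_mod_cast h3
  have h4' : c < a + ε := by exact_mod_cast h4
  intro x hx
  have hm := min_le_left ε (δ / 2)
  apply H x (by rw [mem_closedBall, dist_eq_norm]; linarith) u
    (by rw [mem_closedBall, dist_eq_norm]; linarith)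
  · rw [ha, hc]; exact_mod_cast h4'.le
  · rw [ha, hc]; exact_mod_cast (by linarith : a ≤ c + ε)
  · exact hp
  · rw [mem_closedBall, dist_eq_norm, sub_zero]; linarith

lemma LocPR.real {f : X → EReal} {xb : X} {ρ ε : ℝ} (h : LocPR f xb ρ ε) (hbot : ∀ x, f x ≠ ⊥)
    {u p x : X} (hp : p ∈ LimitingSubdiff f u) (hu : ‖u - xb‖ ≤ ε) (hpn : ‖p‖ ≤ ε)
    (hx : ‖x - xb‖ ≤ ε) (hxt : f x ≠ ⊤) :
    (f u).toReal + (⟪p, x - u⟫ - ρ / 2 * ‖x - u‖ ^ 2) ≤ (f x).toReal := by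
  obtain ⟨h1, h2⟩ := h.2.2 u p hp hu hpn
  have h3 := h2 x hx
  rw [← EReal.coe_toReal h1 (hbot _), ← EReal.coe_toReal hxt (hbot _)] at h3
  exact_mod_cast h3

lemma LocPR.hypo {f : X → EReal} {xb : X} {ρ ε : ℝ} (h : LocPR f xb ρ ε) (hbot : ∀ x, f x ≠ ⊥)
    {u p u' p' : X} (hp : p ∈ LimitingSubdiff f u) (hu : ‖u - xb‖ ≤ ε) (hpn : ‖p‖ ≤ ε)
    (hp' : p' ∈ LimitingSubdiff f u') (hu' : ‖u' - xb‖ ≤ ε) (hpn' : ‖p'‖ ≤ ε) :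
    -ρ * ‖u - u'‖ ^ 2 ≤ ⟪p - p', u - u'⟫ := by
  have h1 := h.real hbot hp hu hpn hu' (h.2.2 _ _ hp' hu' hpn').1
  have h2 := h.real hbot hp' hu' hpn' hu (h.2.2 _ _ hp hu hpn).1
  rw [inner_sub_left]
  have h3 : ⟪p, u' - u⟫ = - ⟪p, u - u'⟫ := by rw [← inner_neg_right, neg_sub]
  rw [norm_sub_rev u' u, h3] at h1
  linarith

lemma LocPR.zmono {f : X → EReal} {xb : X} {ρ ε : ℝ} (h : LocPR f xb ρ ε) (hbot : ∀ x, f x ≠ ⊥)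
    {lam : ℝ} (hl : 0 < lam) (hlr : lam * ρ = 1 / 2)
    {u p u' p' : X} (hp : p ∈ LimitingSubdiff f u) (hu : ‖u - xb‖ ≤ ε) (hpn : ‖p‖ ≤ ε)
    (hp' : p' ∈ LimitingSubdiff f u') (hu' : ‖u' - xb‖ ≤ ε) (hpn' : ‖p'‖ ≤ ε) :
    1 / 2 * ‖u - u'‖ ^ 2 ≤ ⟪u - u', (u + lam • p) - (u' + lam • p')⟫ := by
  have h1 := h.hypo hbot hp hu hpn hp' hu' hpn'
  have e : (u + lam • p) - (u' + lam • p') = (u - u') + lam • (p - p') := by module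
  rw [e, inner_add_right, inner_smul_right, real_inner_self_eq_norm_sq, real_inner_comm]
  have := mul_le_mul_of_nonneg_left h1 hl.le
  have e2 : lam * (-ρ * ‖u - u'‖ ^ 2) = - (1 / 2) * ‖u - u'‖ ^ 2 := by rw [← hlr]; ring
  linarith

lemma frechet_sub_limiting {f : X → EReal} {x p : X} (h : p ∈ FrechetSubdiff f x) :
    p ∈ LimitingSubdiff f x :=
  ⟨fun _ => x, fun _ => p, fun _ => h, tendsto_const_nhds, tendsto_const_nhds, tendsto_const_nhds⟩

/-- A point minimizing up to a quadratic on a ball has the Fréchet subgradient. -/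
lemma frechet_of_quad {f : X → EReal} {x p : X} {c δ : ℝ} (hδ : 0 < δ) (hc : 0 ≤ c) (hx : f x ≠ ⊤)
    (h : ∀ y, ‖y - x‖ < δ → f x + ((⟪p, y - x⟫ - c * ‖y - x‖ ^ 2 : ℝ) : EReal) ≤ f y) :
    p ∈ FrechetSubdiff f x := by
  refine ⟨hx, fun ε hε => ⟨min δ (ε / (c + 1)), by positivity, fun y hy => ?_⟩⟩
  refine le_trans ?_ (h y (hy.trans_le (min_le_left _ _)))
  refine add_le_add le_rfl (EReal.coe_le_coe_iff.2 ?_)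
  have h1 : ‖y - x‖ < ε / (c + 1) := hy.trans_le (min_le_right _ _)
  rw [lt_div_iff₀ (by linarith)] at h1
  have h2 := norm_nonneg (y - x)
  have : c * ‖y - x‖ ^ 2 ≤ ε * ‖y - x‖ := by nlinarith
  linarith

lemma exists_min {n : ℕ} {f : EuclideanSpace ℝ (Fin n) → EReal} 
    (hlsc : LowerSemicontinuous f) (c : EuclideanSpace ℝ (Fin n) → ℝ) (hc : Continuous c)
    (xb : EuclideanSpace ℝ (Fin n)) (γ : ℝ) (hγ : 0 ≤ γ) :
    ∃ x ∈ closedBall xb γ, ∀ y ∈ closedBall xb γ, f x + (c x : EReal) ≤ f y + (c y : EReal) := by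
  have h1 : LowerSemicontinuous (fun x => ((c x : ℝ) : EReal)) :=
    (continuous_coe_real_ereal.comp hc).lowerSemicontinuous
  have h2 : LowerSemicontinuous (fun x => f x + (c x : EReal)) :=
    hlsc.add' h1 (fun x => EReal.continuousAt_add (by simp) (by simp))
  obtain ⟨x, hx, hm⟩ := LowerSemicontinuousOn.exists_isMinOn (s := closedBall xb γ)
    ⟨xb, mem_closedBall_self hγ⟩ (isCompact_closedBall xb γ) (h2.lowerSemicontinuousOn _)
  exact ⟨x, hx, fun y hy => hm hy⟩
lemma normal_ineq {E : Type*} [NormedAddCommGroup E] [InnerProductSpace ℝ E] [CompleteSpace E]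
    (Ω : Set (E × E)) (m : E → E) (κ : ℝ) (hκ : 0 < κ) (p : E) (η : ℝ) (hη : 0 < η)
    (hΩ : ∀ p' ∈ closedBall p η, (m p', p') ∈ Ω)
    (hLip : ∀ q ∈ closedBall p η, ∀ p' ∈ closedBall p η, ‖m q - m p'‖ ≤ κ * ‖q - p'‖)
    (hmono : ∀ q ∈ closedBall p η, ∀ p' ∈ closedBall p η, 0 ≤ ⟪q - p', m q - m p'⟫)
    (w : E × E) (hw : w ∈ FrechetNormalP Ω (m p, p)) :
    ‖w.2‖ ≤ κ * ‖w.1‖ ∧ ⟪w.1, w.2⟫ ≤ 0 := by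
  obtain ⟨w1, w2⟩ := w
  simp only
  by_cases hw2 : w2 = 0
  · subst hw2
    simp; positivity
  have hn2 : 0 < ‖w2‖ := norm_pos_iff.2 hw2
  have hp0 : p ∈ closedBall p η := mem_closedBall_self hη.le
  constructor
  · apply le_of_forall_pos_le_add
    intro e he
    obtain ⟨δ, hδ, H⟩ := hw (e / (κ + 1)) (by positivity)
    set t := min (η / ‖w2‖) (δ / (2 * (κ + 1) * ‖w2‖)) with ht
    have ht0 : 0 < t := by positivity
    have ht1 : t * ‖w2‖ ≤ η := by
      rw [← le_div_iff₀ hn2]; exact min_le_left _ _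
    have ht2 : t * (2 * (κ + 1) * ‖w2‖) ≤ δ := by
      rw [← le_div_iff₀ (by positivity)]; exact min_le_right _ _
    have hnt : ‖t • w2‖ = t * ‖w2‖ := by rw [norm_smul, Real.norm_of_nonneg ht0.le]
    have hmem : p + t • w2 ∈ closedBall p η := by
      rw [mem_closedBall, dist_eq_norm, add_sub_cancel_left, hnt]; exact ht1
    have hl := hLip _ hmem _ hp0
    rw [add_sub_cancel_left, hnt] at hl
    have hd : dist (m (p + t • w2), p + t • w2) (m p, p) ≤ (κ + 1) * (t * ‖w2‖) := by
      rw [Prod.dist_eq, max_le_iff, dist_eq_norm, dist_eq_norm]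
      simp only [add_sub_cancel_left, hnt]
      have : 0 ≤ t * ‖w2‖ := by positivity
      constructor <;> nlinarith
    have h1 := H _ (hΩ _ hmem) (by
      refine hd.trans_lt ?_
      have : 0 < (κ + 1) * (t * ‖w2‖) := by positivity
      linarith)
    simp only [add_sub_cancel_left] at h1
    rw [inner_smul_right, real_inner_self_eq_norm_sq] at h1
    have h2 : e / (κ + 1) * dist (m (p + t • w2), p + t • w2) (m p, p) ≤ e * (t * ‖w2‖) := by
      calc _ ≤ e / (κ + 1) * ((κ + 1) * (t * ‖w2‖)) := by gcongr
        _ = _ := by field_simp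
    have h3 := neg_le_of_abs_le (abs_real_inner_le_norm w1 (m (p + t • w2) - m p))
    have h4 : ‖w1‖ * ‖m (p + t • w2) - m p‖ ≤ ‖w1‖ * (κ * (t * ‖w2‖)) := by gcongr
    have h5 : (t * ‖w2‖) * ‖w2‖ ≤ (t * ‖w2‖) * (κ * ‖w1‖ + e) := by nlinarith
    exact le_of_mul_le_mul_left h5 (by positivity)
  · have key : ∀ lam : ℝ, 0 < lam → ‖w2‖ ≤ ‖lam • w1 - w2‖ := by
      intro lam hlam
      obtain ⟨β, hβ, hS⟩ := surj_S m κ p η hη hLip hmono lam hlam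
      apply le_of_forall_pos_le_add
      intro e he
      set C := 1 + 1 / lam with hC
      have hC0 : 0 < C := by positivity
      obtain ⟨δ, hδ, H⟩ := hw (e / (lam * C)) (by positivity)
      set t := min (β / ‖w2‖) (δ / (2 * C * ‖w2‖)) with ht
      have ht0 : 0 < t := by positivity
      have ht1 : t * ‖w2‖ ≤ β := by
        rw [← le_div_iff₀ hn2]; exact min_le_left _ _
      have ht2 : t * (2 * C * ‖w2‖) ≤ δ := by
        rw [← le_div_iff₀ (by positivity)]; exact min_le_right _ _
      have hnt : ‖t • w2‖ = t * ‖w2‖ := by rw [norm_smul, Real.norm_of_nonneg ht0.le]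
      obtain ⟨p', hp', hpe⟩ := hS (m p + lam • p + t • w2) (by
        rw [add_sub_cancel_left, hnt]; exact ht1)
      have hmn := hmono _ hp' _ hp0
      set dx := m p' - m p with hdx
      set dp := p' - p with hdp
      have hsum : dx + lam • dp = t • w2 := by
        have : dx + lam • dp = (m p' + lam • p') - (m p + lam • p) := by
          rw [hdx, hdp]; module
        rw [this, hpe]; module
      have hsq : ‖dx‖ ^ 2 + (lam * ‖dp‖) ^ 2 ≤ (t * ‖w2‖) ^ 2 := by
        rw [← hnt, ← hsum, norm_add_sq_real, inner_smul_right, real_inner_comm, norm_smul,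
          Real.norm_of_nonneg hlam.le]
        have : 0 ≤ lam * ⟪dp, dx⟫ := by positivity
        linarith
      have htw : 0 < t * ‖w2‖ := by positivity
      have hdx1 : ‖dx‖ ≤ t * ‖w2‖ := by
        apply le_of_sq_le_sq _ htw.le
        nlinarith [sq_nonneg (lam * ‖dp‖)]
      have hdp1 : lam * ‖dp‖ ≤ t * ‖w2‖ := by
        apply le_of_sq_le_sq _ htw.le
        nlinarith [sq_nonneg (‖dx‖)]
      have hd : dist (m p', p') (m p, p) ≤ C * (t * ‖w2‖) := by
        rw [Prod.dist_eq, max_le_iff, dist_eq_norm, dist_eq_norm]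
        simp only
        rw [← hdx, ← hdp]
        have h1 : ‖dp‖ ≤ 1 / lam * (t * ‖w2‖) := by
          rw [div_mul_eq_mul_div, one_mul, le_div_iff₀ hlam]; linarith
        have h2 : 0 ≤ 1 / lam * (t * ‖w2‖) := by positivity
        rw [hC]
        constructor <;> nlinarith
      have h1 := H _ (hΩ _ hp') (by
        refine hd.trans_lt ?_
        have : 0 < C * (t * ‖w2‖) := by positivity
        linarith)
      simp only at h1
      rw [← hdx, ← hdp] at h1
      have h2 : e / (lam * C) * dist (m p', p') (m p, p) ≤ e / lam * (t * ‖w2‖) := by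
        calc _ ≤ e / (lam * C) * (C * (t * ‖w2‖)) := by gcongr
          _ = _ := by field_simp
      have h3 : lam * (⟪w1, dx⟫ + ⟪w2, dp⟫) = ⟪lam • w1 - w2, dx⟫ + t * ‖w2‖ ^ 2 := by
        clear_value dx dp
        have : ⟪w2, lam • dp⟫ = ⟪w2, t • w2 - dx⟫ := by
          rw [← hsum, add_sub_cancel_left]
        rw [inner_smul_right, inner_sub_right, inner_smul_right, real_inner_self_eq_norm_sq] at this
        rw [inner_sub_left, inner_smul_left]
        simp only [conj_trivial]
        linarith
      have h4 : lam * (⟪w1, dx⟫ + ⟪w2, dp⟫) ≤ e * (t * ‖w2‖) := by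
        calc _ ≤ lam * (e / lam * (t * ‖w2‖)) := by gcongr; linarith
          _ = _ := by field_simp
      have h5 := neg_le_of_abs_le (abs_real_inner_le_norm (lam • w1 - w2) dx)
      have h6 : ‖lam • w1 - w2‖ * ‖dx‖ ≤ ‖lam • w1 - w2‖ * (t * ‖w2‖) := by gcongr
      have h7 : (t * ‖w2‖) * ‖w2‖ ≤ (t * ‖w2‖) * (‖lam • w1 - w2‖ + e) := by nlinarith
      exact le_of_mul_le_mul_left h7 htw
    by_contra! hcon
    have hw1 : 0 < ‖w1‖ := by
      rw [norm_pos_iff]; rintro rfl; simp at hcon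
    set lam := ⟪w1, w2⟫ / ‖w1‖ ^ 2 with hlam
    have hlam0 : 0 < lam := by positivity
    have h1 := key lam hlam0
    have h2 : ‖w2‖ ^ 2 ≤ ‖lam • w1 - w2‖ ^ 2 := by gcongr
    rw [norm_sub_sq_real, inner_smul_left, norm_smul, mul_pow] at h2
    simp only [conj_trivial, Real.norm_eq_abs, sq_abs] at h2
    have h3 : lam * ‖w1‖ ^ 2 = ⟪w1, w2⟫ := by rw [hlam]; field_simp
    have h4 : lam ^ 2 * ‖w1‖ ^ 2 = lam * ⟪w1, w2⟫ := by rw [← h3]; ring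
    have h5 : 0 < lam * ⟪w1, w2⟫ := by positivity
    linarith

lemma part1 {n : ℕ}
    (f : EuclideanSpace ℝ (Fin n) → EReal) (hbot : ∀ x, f x ≠ ⊥)
    (xb : EuclideanSpace ℝ (Fin n)) (ρ ε : ℝ) (hloc : LocPR f xb ρ ε) (hfin : f xb ≠ ⊤)
    (κ : ℝ) (hκ : 0 < κ) (hts : TiltStableWith f xb κ)
    (u w : EuclideanSpace ℝ (Fin n)) (hw : w ∈ SecondSubdiff f xb 0 u) :
    ‖u‖ ≤ κ * ‖w‖ ∧ 0 ≤ ⟪w, u⟫ := by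
  obtain ⟨γ, hγ, V, hV, m, harg, hLipV, hm0⟩ := hts
  obtain ⟨s, hs, hsV⟩ := Metric.mem_nhds_iff.1 hV
  have hρ := hloc.1
  have hε := hloc.2.1
  have hmem : ∀ p ∈ V, m p ∈ TiltArgmin f xb γ p := by
    intro p hp; rw [harg p hp]; rfl
  have hmfin : ∀ p ∈ V, f (m p) ≠ ⊤ := by
    intro p hp htop
    have h1 := (hmem p hp).2 xb (mem_closedBall_self hγ.le)
    rw [htop, ← EReal.coe_toReal hfin (hbot _), EReal.top_sub_coe, top_le_iff] at h1
    exact EReal.coe_ne_top _ (by exact_mod_cast h1)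
  have hreal : ∀ p ∈ V, ∀ y ∈ closedBall xb γ, f y ≠ ⊤ →
      (f (m p)).toReal - ⟪p, m p⟫ ≤ (f y).toReal - ⟪p, y⟫ := by
    intro p hp y hy hyt
    have h1 := (hmem p hp).2 y hy
    rw [← EReal.coe_toReal hyt (hbot _), ← EReal.coe_toReal (hmfin p hp) (hbot _)] at h1
    exact_mod_cast h1
  have hmono : ∀ p ∈ V, ∀ p' ∈ V, 0 ≤ ⟪p - p', m p - m p'⟫ := by
    intro p hp p' hp'
    have h1 := hreal p hp _ (hmem p' hp').1 (hmfin p' hp')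
    have h2 := hreal p' hp' _ (hmem p hp).1 (hmfin p hp)
    simp only [inner_sub_left, inner_sub_right]
    linarith
  have hLip : ∀ p ∈ V, ∀ p' ∈ V, ‖m p - m p'‖ ≤ κ * ‖p - p'‖ := by
    intro p hp p' hp'
    have := hLipV.dist_le_mul p hp p' hp'
    rwa [Real.coe_toNNReal κ hκ.le, dist_eq_norm, dist_eq_norm] at this
  have h0V : (0 : EuclideanSpace ℝ (Fin n)) ∈ V := mem_of_mem_nhds hV
  have hnear : ∀ p ∈ V, ‖m p - xb‖ ≤ κ * ‖p‖ := by
    intro p hp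
    have := hLip p hp 0 h0V
    rwa [hm0, sub_zero] at this
  have hG : ∀ p ∈ V, κ * ‖p‖ < γ → p ∈ LimitingSubdiff f (m p) := by
    intro p hp hpg
    apply frechet_sub_limiting
    apply frechet_of_quad (c := 0) (δ := γ - κ * ‖p‖) (by linarith) le_rfl (hmfin p hp)
    intro y hy
    by_cases hyt : f y = ⊤
    · rw [hyt]; exact le_top
    have hyb : y ∈ closedBall xb γ := by
      rw [mem_closedBall, dist_eq_norm]
      have := norm_add_le (y - m p) (m p - xb)
      rw [sub_add_sub_cancel] at this
      linarith [hnear p hp]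
    have h1 := hreal p hp y hyb hyt
    rw [← EReal.coe_toReal hyt (hbot _), ← EReal.coe_toReal (hmfin p hp) (hbot _)]
    rw [← EReal.coe_add, EReal.coe_le_coe_iff, inner_sub_right]
    linarith
  -- radius
  obtain ⟨η, hη, hη1, hη2, hη3, hη4⟩ : ∃ η > 0, η < s ∧ κ * η < γ ∧ κ * η ≤ ε ∧ η ≤ ε := by
    refine ⟨min (s / 2) (min (γ / (2 * κ)) (min (ε / κ) ε)), by positivity, ?_, ?_, ?_, ?_⟩
    · exact (min_le_left _ _).trans_lt (by linarith)
    · have : min (s / 2) (min (γ / (2 * κ)) (min (ε / κ) ε)) ≤ γ / (2 * κ) :=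
        (min_le_right _ _).trans (min_le_left _ _)
      calc _ ≤ κ * (γ / (2 * κ)) := by gcongr
        _ = γ / 2 := by field_simp
        _ < γ := by linarith
    · have : min (s / 2) (min (γ / (2 * κ)) (min (ε / κ) ε)) ≤ ε / κ :=
        (min_le_right _ _).trans ((min_le_right _ _).trans (min_le_left _ _))
      calc _ ≤ κ * (ε / κ) := by gcongr
        _ = ε := by field_simp
    · exact (min_le_right _ _).trans ((min_le_right _ _).trans (min_le_right _ _))
  have hball : ∀ p ∈ closedBall (0 : EuclideanSpace ℝ (Fin n)) η, p ∈ V ∧ ‖p‖ ≤ η := by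
    intro p hp
    refine ⟨hsV (closedBall_subset_ball hη1 hp), ?_⟩
    rwa [mem_closedBall, dist_zero_right] at hp
  have hGb : ∀ p ∈ closedBall (0 : EuclideanSpace ℝ (Fin n)) η,
      p ∈ LimitingSubdiff f (m p) ∧ ‖m p - xb‖ ≤ ε ∧ ‖p‖ ≤ ε := by
    intro p hp
    obtain ⟨h1, h2⟩ := hball p hp
    have h3 : κ * ‖p‖ ≤ κ * η := by gcongr
    exact ⟨hG p h1 (by linarith), by linarith [hnear p h1], by linarith⟩
  set lam := 1 / (2 * ρ) with hlam
  have hl0 : 0 < lam := by positivity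
  have hlr : lam * ρ = 1 / 2 := by rw [hlam]; field_simp
  obtain ⟨β, hβ, hS⟩ := surj_S m κ 0 η hη (fun p hp p' hp' => hLip p (hball p hp).1 p' (hball p' hp').1)
    (fun p hp p' hp' => hmono p (hball p hp).1 p' (hball p' hp').1) lam hl0
  rw [hm0, smul_zero, add_zero] at hS
  have hloc2 : ∀ x p, p ∈ LimitingSubdiff f x → ‖x - xb‖ ≤ ε → ‖p‖ ≤ ε →
      ‖x + lam • p - xb‖ ≤ β → x = m p := by
    intro x p hp hx hpn hz
    obtain ⟨p', hp', he⟩ := hS _ hz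
    obtain ⟨h1, h2, h3⟩ := hGb p' hp'
    have h4 := hloc.zmono hbot hl0 hlr hp hx hpn h1 h2 h3
    rw [he, sub_self, inner_zero_right] at h4
    have h5 : ‖x - m p'‖ = 0 := by nlinarith [norm_nonneg (x - m p')]
    have h6 : x = m p' := sub_eq_zero.1 (norm_eq_zero.1 h5)
    have h7 : p' = p := by
      rw [← h6] at he
      exact smul_right_injective _ hl0.ne' (add_left_cancel he)
    rw [← h7]; exact h6
  obtain ⟨zs, ws, hzw, hz, hwl⟩ := hw
  have hz1 : Tendsto (fun k => (zs k).1) atTop (𝓝 xb) := (continuous_fst.tendsto _).comp hz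
  have hz2 : Tendsto (fun k => (zs k).2) atTop (𝓝 0) := (continuous_snd.tendsto _).comp hz
  have hw1 : Tendsto (fun k => (ws k).1) atTop (𝓝 w) := (continuous_fst.tendsto _).comp hwl
  have hw2 : Tendsto (fun k => (ws k).2) atTop (𝓝 (-u)) := (continuous_snd.tendsto _).comp hwl
  have ev1 : ∀ᶠ k in atTop, ‖(zs k).1 - xb‖ < ε := by
    have := Metric.tendsto_nhds.1 hz1 ε hε
    simpa [dist_eq_norm] using this
  have ev2 : ∀ᶠ k in atTop, ‖(zs k).2‖ < η := by
    have := Metric.tendsto_nhds.1 hz2 η hη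
    simpa [dist_eq_norm] using this
  have ev3 : ∀ᶠ k in atTop, ‖(zs k).1 + lam • (zs k).2 - xb‖ < β := by
    have h1 : Tendsto (fun k => (zs k).1 + lam • (zs k).2) atTop (𝓝 (xb + lam • 0)) :=
      hz1.add (hz2.const_smul lam)
    rw [smul_zero, add_zero] at h1
    have := Metric.tendsto_nhds.1 h1 β hβ
    simpa [dist_eq_norm] using this
  have ev : ∀ᶠ k in atTop, ‖(ws k).2‖ ≤ κ * ‖(ws k).1‖ ∧ ⟪(ws k).1, (ws k).2⟫ ≤ 0 := by
    filter_upwards [ev1, ev2, ev3] with k h1 h2 h3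
    obtain ⟨hzG, hwN⟩ := hzw k
    have hx := hloc2 _ _ hzG h1.le (by linarith) h3.le
    have hzk : zs k = (m (zs k).2, (zs k).2) := Prod.ext hx rfl
    rw [hzk] at hwN
    have hsub : ∀ p ∈ closedBall (zs k).2 (η - ‖(zs k).2‖),
        p ∈ closedBall (0 : EuclideanSpace ℝ (Fin n)) η := by
      intro p hp
      rw [mem_closedBall, dist_eq_norm] at hp
      rw [mem_closedBall, dist_zero_right]
      have := norm_add_le (p - (zs k).2) (zs k).2
      rw [sub_add_cancel] at this
      linarith
    exact normal_ineq _ m κ hκ (zs k).2 (η - ‖(zs k).2‖) (by linarith)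
      (fun p hp => (hGb p (hsub p hp)).1)
      (fun p hp p' hp' => hLip p (hball p (hsub p hp)).1 p' (hball p' (hsub p' hp')).1)
      (fun p hp p' hp' => hmono p (hball p (hsub p hp)).1 p' (hball p' (hsub p' hp')).1)
      (ws k) hwN
  constructor
  · have := le_of_tendsto_of_tendsto hw2.norm (hw1.norm.const_mul κ) (ev.mono fun k h => h.1)
    rwa [norm_neg] at this
  · have := le_of_tendsto (hw1.inner hw2) (ev.mono fun k h => h.2)
    rw [inner_neg_right] at this
    linarith
lemma compact_excl {n : ℕ}
    (f : EuclideanSpace ℝ (Fin n) → EReal) (xb : EuclideanSpace ℝ (Fin n)) (ρ : ℝ)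
    (μ r : ℝ) (hμ : 0 < μ) (hr : r < μ⁻¹)
    (H : ∀ u w : EuclideanSpace ℝ (Fin n), w ∈ SecondSubdiff f xb 0 u →
        ‖u‖ ≤ μ * ‖w‖ ∧ -r * ‖u‖ ^ 2 ≤ ⟪w, u⟫) (κ : ℝ) (hκ : μ < κ) :
    ∃ δ > 0, ∀ x p, p ∈ LimitingSubdiff f x → dist (x, p) (xb, 0) < δ →
      ∀ v, ‖v‖ = 1 → ∀ h ∈ Set.Icc (-ρ) κ⁻¹,
        (h • v, -v) ∉ FrechetNormalP
          {q : EuclideanSpace ℝ (Fin n) × EuclideanSpace ℝ (Fin n) |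
            q.2 ∈ LimitingSubdiff f q.1} (x, p) := by
  by_contra! hcon
  have hk : ∀ k : ℕ, (0 : ℝ) < 1 / ((k : ℝ) + 1) := fun k => by positivity
  choose x p hp hd v hv h hh hN using fun k : ℕ => hcon _ (hk k)
  have hcomp : IsCompact (sphere (0 : EuclideanSpace ℝ (Fin n)) 1 ×ˢ Set.Icc (-ρ) κ⁻¹) :=
    (isCompact_sphere _ _).prod isCompact_Icc
  obtain ⟨⟨v', h'⟩, hmem, φ, hφ, hlim⟩ := hcomp.tendsto_subseq (x := fun k => (v k, h k))
    (fun k => ⟨by simp [hv k], hh k⟩)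
  have hv' : ‖v'‖ = 1 := by simpa using hmem.1
  have hvl : Tendsto (fun k => v (φ k)) atTop (𝓝 v') := (continuous_fst.tendsto _).comp hlim
  have hhl : Tendsto (fun k => h (φ k)) atTop (𝓝 h') := (continuous_snd.tendsto _).comp hlim
  have hz : Tendsto (fun k => (x k, p k)) atTop (𝓝 (xb, 0)) := by
    rw [tendsto_iff_dist_tendsto_zero]
    exact squeeze_zero (fun _ => dist_nonneg) (fun k => (hd k).le)
      tendsto_one_div_add_atTop_nhds_zero_nat
  have hS : h' • v' ∈ SecondSubdiff f xb 0 v' := by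
    refine ⟨fun k => (x (φ k), p (φ k)), fun k => (h (φ k) • v (φ k), - v (φ k)),
      fun k => ⟨hp _, hN _⟩, hz.comp hφ.tendsto_atTop, ?_⟩
    exact (hhl.smul hvl).prodMk_nhds hvl.neg
  obtain ⟨h1, h2⟩ := H _ _ hS
  rw [norm_smul, hv'] at h1
  rw [inner_smul_left, real_inner_self_eq_norm_sq, hv'] at h2
  simp only [conj_trivial, Real.norm_eq_abs, one_pow, mul_one] at h1 h2
  have h3 : h' ≤ κ⁻¹ := hmem.2.2
  have h4 : κ⁻¹ < μ⁻¹ := by gcongr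
  have h5 : μ⁻¹ ≤ |h'| := by rw [inv_le_iff_one_le_mul₀ hμ]; linarith
  rcases abs_cases h' with ⟨h6, h7⟩ | ⟨h6, h7⟩ <;> linarith

lemma prox_exists {n : ℕ}
    (f : EuclideanSpace ℝ (Fin n) → EReal) (hbot : ∀ x, f x ≠ ⊥) (hlsc : LowerSemicontinuous f)
    (xb : EuclideanSpace ℝ (Fin n)) (ρ ε : ℝ) (hloc : LocPR f xb ρ ε) (hfin : f xb ≠ ⊤)
    (h0 : (0 : EuclideanSpace ℝ (Fin n)) ∈ LimitingSubdiff f xb)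
    (lam : ℝ) (hl : 0 < lam) (hlr : lam * ρ = 1 / 2) :
    ∃ b > 0, ∀ z ∈ ball xb b, ∃ u, lam⁻¹ • (z - u) ∈ LimitingSubdiff f u ∧ ‖u - xb‖ ≤ ε ∧
      ‖lam⁻¹ • (z - u)‖ ≤ ε := by
  have hρ := hloc.1
  have hε := hloc.2.1
  refine ⟨min (ε / 8) (ε * lam / 5), by positivity, fun z hz => ?_⟩
  rw [mem_ball, dist_eq_norm, lt_min_iff] at hz
  obtain ⟨hz1, hz2⟩ := hz
  obtain ⟨u, hu, hmin⟩ := exists_min hlsc (fun x => 1 / (2 * lam) * ‖x - z‖ ^ 2) (by fun_prop) xb ε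
    hε.le
  have hu' : ‖u - xb‖ ≤ ε := by rwa [mem_closedBall, dist_eq_norm] at hu
  have hmb := hmin xb (mem_closedBall_self hε.le)
  have hut : f u ≠ ⊤ := by
    intro htop
    rw [htop, ← EReal.coe_toReal hfin (hbot _), EReal.top_add_coe, top_le_iff] at hmb
    exact EReal.coe_ne_top _ (by exact_mod_cast hmb)
  have hminr : ∀ y ∈ closedBall xb ε, f y ≠ ⊤ →
      (f u).toReal + 1 / (2 * lam) * ‖u - z‖ ^ 2 ≤ (f y).toReal + 1 / (2 * lam) * ‖y - z‖ ^ 2 := by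
    intro y hy hyt
    have h1 := hmin y hy
    rw [← EReal.coe_toReal hyt (hbot _), ← EReal.coe_toReal hut (hbot _)] at h1
    exact_mod_cast h1
  have h1 := hminr xb (mem_closedBall_self hε.le) hfin
  have h2 := hloc.real hbot h0 (by simpa using hε.le) (by simpa using hε.le) hu' hut
  rw [inner_zero_left] at h2
  have h3 : ‖u - z‖ ^ 2 ≤ 1 / 2 * ‖u - xb‖ ^ 2 + ‖xb - z‖ ^ 2 := by
    have h4 : 1 / (2 * lam) * ‖u - z‖ ^ 2 ≤ ρ / 2 * ‖u - xb‖ ^ 2 + 1 / (2 * lam) * ‖xb - z‖ ^ 2 := by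
      linarith
    have h5 := mul_le_mul_of_nonneg_left h4 (by positivity : 0 ≤ 2 * lam)
    have e1 : 2 * lam * (1 / (2 * lam) * ‖u - z‖ ^ 2) = ‖u - z‖ ^ 2 := by field_simp
    have e2 : 2 * lam * (ρ / 2 * ‖u - xb‖ ^ 2 + 1 / (2 * lam) * ‖xb - z‖ ^ 2)
      = lam * ρ * ‖u - xb‖ ^ 2 + ‖xb - z‖ ^ 2 := by field_simp
    rw [e1, e2, hlr] at h5
    exact h5
  rw [norm_sub_rev xb z] at h3
  have h4 : ‖u - xb‖ ≤ 4 * ‖z - xb‖ := by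
    have h5 : ‖u - xb‖ ≤ ‖u - z‖ + ‖z - xb‖ := by
      have := norm_add_le (u - z) (z - xb); rwa [sub_add_sub_cancel] at this
    by_contra! hc
    have h6 : 0 ≤ ‖u - xb‖ - ‖z - xb‖ := by linarith [norm_nonneg (z - xb)]
    have h7 : (‖u - xb‖ - ‖z - xb‖) ^ 2 ≤ ‖u - z‖ ^ 2 := by
      apply pow_le_pow_left₀ h6; linarith
    nlinarith [norm_nonneg (z - xb), norm_nonneg (u - xb)]
  have h5 : ‖z - u‖ ≤ 5 * ‖z - xb‖ := by
    have := norm_add_le (z - xb) (xb - u)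
    rw [sub_add_sub_cancel, norm_sub_rev xb u] at this
    linarith
  refine ⟨u, ?_, hu', ?_⟩
  · apply frechet_sub_limiting
    apply frechet_of_quad (c := 1 / (2 * lam)) (δ := ε / 2) (by linarith) (by positivity) hut
    intro y hy
    by_cases hyt : f y = ⊤
    · rw [hyt]; exact le_top
    have hyb : y ∈ closedBall xb ε := by
      rw [mem_closedBall, dist_eq_norm]
      have := norm_add_le (y - u) (u - xb)
      rw [sub_add_sub_cancel] at this
      linarith
    have h6 := hminr y hyb hyt
    rw [← EReal.coe_toReal hyt (hbot _), ← EReal.coe_toReal hut (hbot _)]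
    rw [← EReal.coe_add, EReal.coe_le_coe_iff, inner_smul_left]
    simp only [conj_trivial]
    have e1 : ‖y - z‖ ^ 2 = ‖y - u‖ ^ 2 - 2 * ⟪z - u, y - u⟫ + ‖u - z‖ ^ 2 := by
      have : y - z = (y - u) - (z - u) := by abel
      rw [this, norm_sub_sq_real, norm_sub_rev z u, real_inner_comm]
    rw [e1] at h6
    have e2 : 1 / (2 * lam) * (‖y - u‖ ^ 2 - 2 * ⟪z - u, y - u⟫ + ‖u - z‖ ^ 2)
      = 1 / (2 * lam) * ‖y - u‖ ^ 2 - lam⁻¹ * ⟪z - u, y - u⟫ + 1 / (2 * lam) * ‖u - z‖ ^ 2 := by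
      field_simp
    linarith
  · rw [norm_smul, Real.norm_of_nonneg (by positivity), inv_mul_le_iff₀ hl]
    linarith

/-- Symmetry of the derivative of a gradient map. -/
lemma grad_symm {n : ℕ} (P : EuclideanSpace ℝ (Fin n) → EuclideanSpace ℝ (Fin n))
    (φ : EuclideanSpace ℝ (Fin n) → ℝ) (c : EuclideanSpace ℝ (Fin n)) (b : ℝ)
    (hφ : ∀ z ∈ ball c b, HasFDerivAt φ (innerSL ℝ (P z)) z)
    (z : EuclideanSpace ℝ (Fin n)) (hz : z ∈ ball c b) (hd : DifferentiableAt ℝ P z)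
    (v w : EuclideanSpace ℝ (Fin n)) :
    ⟪fderiv ℝ P z v, w⟫ = ⟪v, fderiv ℝ P z w⟫ := by
  let B : EuclideanSpace ℝ (Fin n) →L[ℝ] EuclideanSpace ℝ (Fin n) →L[ℝ] ℝ :=
    LinearMap.mkContinuous₂ (innerₗ _) 1 (fun x y => by
      simpa using abs_real_inner_le_norm x y)
  have hB : ∀ x y, B x y = ⟪x, y⟫ := fun x y => rfl
  have h1 : HasFDerivAt (fun y => B (P y)) (B.comp (fderiv ℝ P z)) z :=
    B.hasFDerivAt.comp z hd.hasFDerivAt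
  have h2 : ∀ᶠ y in 𝓝 z, HasFDerivAt φ (B (P y)) y := by
    filter_upwards [isOpen_ball.mem_nhds hz] with y hy
    have h3 : B (P y) = innerSL ℝ (P y) := by ext w; rfl
    rw [h3]; exact hφ y hy
  have := second_derivative_symmetric_of_eventually h2 h1 v w
  simp only [ContinuousLinearMap.comp_apply, hB] at this
  rw [this, real_inner_comm]

lemma hasFDerivAt_of_quad {n : ℕ} (φ : EuclideanSpace ℝ (Fin n) → ℝ)
    (z q : EuclideanSpace ℝ (Fin n)) (C : ℝ)
    (h : ∀ᶠ z' in 𝓝 z, |φ z' - φ z - ⟪q, z' - z⟫| ≤ C * ‖z' - z‖ ^ 2) :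
    HasFDerivAt φ (innerSL ℝ q) z := by
  have h1 : (fun z' => φ z' - φ z - ⟪q, z' - z⟫) =O[𝓝 z] fun z' => ‖z' - z‖ ^ 2 := by
    apply Asymptotics.IsBigO.of_bound C
    filter_upwards [h] with z' hz'
    simpa using hz'
  have h2 := h1.hasFDerivAt (𝕜 := ℝ) (by norm_num)
  have h3 : HasFDerivAt (fun z' => ⟪q, z' - z⟫) (innerSL ℝ q) z :=
    (innerSL ℝ q).hasFDerivAt.comp z ((hasFDerivAt_id z).sub_const z)
  have h4 := (h2.add h3).add_const (φ z)
  rw [zero_add] at h4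
  refine h4.congr_of_eventuallyEq (Eventually.of_forall fun y => ?_)
  simp only [Pi.add_apply]
  ring
/-- `P` is a selection of the resolvent of the localized subdifferential. -/
def PM {n : ℕ} (f : EuclideanSpace ℝ (Fin n) → EReal) (xb : EuclideanSpace ℝ (Fin n))
    (lam ε b : ℝ) (P : EuclideanSpace ℝ (Fin n) → EuclideanSpace ℝ (Fin n)) : Prop :=
  ∀ z ∈ ball xb b, lam⁻¹ • (z - P z) ∈ LimitingSubdiff f (P z) ∧ ‖P z - xb‖ ≤ ε ∧
    ‖lam⁻¹ • (z - P z)‖ ≤ ε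

section PMsec

variable {n : ℕ} {f : EuclideanSpace ℝ (Fin n) → EReal} {xb : EuclideanSpace ℝ (Fin n)}
  {lam ε b ρ : ℝ} {P : EuclideanSpace ℝ (Fin n) → EuclideanSpace ℝ (Fin n)}

lemma PM.mono (hP : PM f xb lam ε b P) (h : LocPR f xb ρ ε) (hbot : ∀ x, f x ≠ ⊥)
    (hl : 0 < lam) (hlr : lam * ρ = 1 / 2) {z z' : EuclideanSpace ℝ (Fin n)}
    (hz : z ∈ ball xb b) (hz' : z' ∈ ball xb b) :
    1 / 2 * ‖P z - P z'‖ ^ 2 ≤ ⟪P z - P z', z - z'⟫ := by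
  obtain ⟨h1, h2, h3⟩ := hP z hz
  obtain ⟨h1', h2', h3'⟩ := hP z' hz'
  have := h.zmono hbot hl hlr h1 h2 h3 h1' h2' h3'
  simpa [smul_smul, hl.ne'] using this

lemma PM.lip (hP : PM f xb lam ε b P) (h : LocPR f xb ρ ε) (hbot : ∀ x, f x ≠ ⊥)
    (hl : 0 < lam) (hlr : lam * ρ = 1 / 2) {z z' : EuclideanSpace ℝ (Fin n)}
    (hz : z ∈ ball xb b) (hz' : z' ∈ ball xb b) :
    ‖P z - P z'‖ ≤ 2 * ‖z - z'‖ := by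
  have h1 := hP.mono h hbot hl hlr hz hz'
  have h2 := real_inner_le_norm (P z - P z') (z - z')
  by_contra! hc
  have h3 : 0 < ‖P z - P z'‖ := lt_of_le_of_lt (by positivity) hc
  nlinarith

lemma PM.uniq (hP : PM f xb lam ε b P) (h : LocPR f xb ρ ε) (hbot : ∀ x, f x ≠ ⊥)
    (hl : 0 < lam) (hlr : lam * ρ = 1 / 2) {x p : EuclideanSpace ℝ (Fin n)}
    (hp : p ∈ LimitingSubdiff f x) (hx : ‖x - xb‖ ≤ ε) (hpn : ‖p‖ ≤ ε)
    (hb : x + lam • p ∈ ball xb b) : P (x + lam • p) = x := by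
  obtain ⟨h1, h2, h3⟩ := hP _ hb
  have h4 := h.zmono hbot hl hlr h1 h2 h3 hp hx hpn
  rw [smul_smul, mul_inv_cancel₀ hl.ne', one_smul, add_sub_cancel, sub_self, inner_zero_right] at h4
  have h5 : ‖P (x + lam • p) - x‖ ^ 2 = 0 := le_antisymm (by linarith) (by positivity)
  exact sub_eq_zero.1 (norm_eq_zero.1 (pow_eq_zero_iff two_ne_zero |>.1 h5))

lemma PM.upper (hP : PM f xb lam ε b P) (h : LocPR f xb ρ ε) (hbot : ∀ x, f x ≠ ⊥)
    (hl : 0 < lam) (hlr : lam * ρ = 1 / 2) {z z' : EuclideanSpace ℝ (Fin n)}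
    (hz : z ∈ ball xb b) (hz' : z' ∈ ball xb b) :
    (1 / 2 * ‖z'‖ ^ 2 - (lam * (f (P z')).toReal + 1 / 2 * ‖z' - P z'‖ ^ 2)) -
    (1 / 2 * ‖z‖ ^ 2 - (lam * (f (P z)).toReal + 1 / 2 * ‖z - P z‖ ^ 2)) ≤ ⟪P z', z' - z⟫ := by
  obtain ⟨h1, h2, h3⟩ := hP z hz
  obtain ⟨h1', h2', h3'⟩ := hP z' hz'
  have h4 := h.real hbot h1 h2 h3 h2' (h.2.2 _ _ h1' h2' h3').1
  have h5 := mul_le_mul_of_nonneg_left h4 hl.le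
  have e : lam * ((f (P z)).toReal + (⟪lam⁻¹ • (z - P z), P z' - P z⟫ - ρ / 2 * ‖P z' - P z‖ ^ 2))
    = lam * (f (P z)).toReal + ⟪z - P z, P z' - P z⟫ - 1 / 4 * ‖P z' - P z‖ ^ 2 := by
    rw [real_inner_smul_left]
    have : lam * (lam⁻¹ * ⟪z - P z, P z' - P z⟫) = ⟪z - P z, P z' - P z⟫ := by
      field_simp
    linear_combination this - 1 / 2 * ‖P z' - P z‖ ^ 2 * hlr
  rw [e] at h5
  have h6 : 0 ≤ ‖P z' - P z‖ ^ 2 := by positivity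
  rw [norm_sub_sq_real] at h5 h6
  rw [norm_sub_sq_real, norm_sub_sq_real]
  simp only [inner_sub_left, inner_sub_right, real_inner_self_eq_norm_sq] at h5 h6 ⊢
  rw [real_inner_comm (P z') (P z)] at *
  rw [real_inner_comm (P z') z', real_inner_comm (P z') z] at *
  linarith

lemma PM.grad (hP : PM f xb lam ε b P) (h : LocPR f xb ρ ε) (hbot : ∀ x, f x ≠ ⊥)
    (hl : 0 < lam) (hlr : lam * ρ = 1 / 2) {z : EuclideanSpace ℝ (Fin n)}
    (hz : z ∈ ball xb b) :
    HasFDerivAt (fun z => 1 / 2 * ‖z‖ ^ 2 - (lam * (f (P z)).toReal + 1 / 2 * ‖z - P z‖ ^ 2))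
      (innerSL ℝ (P z)) z := by
  apply hasFDerivAt_of_quad (C := 2)
  filter_upwards [isOpen_ball.mem_nhds hz] with z' hz'
  have h1 := hP.upper h hbot hl hlr hz hz'
  have h2 := hP.upper h hbot hl hlr hz' hz
  have h3 := hP.lip h hbot hl hlr hz' hz
  have h4 := real_inner_le_norm (P z' - P z) (z' - z)
  have h5 : ⟪P z, z - z'⟫ = - ⟪P z, z' - z⟫ := by rw [← inner_neg_right, neg_sub]
  rw [inner_sub_left] at h4
  have h6 := mul_le_mul_of_nonneg_right h3 (norm_nonneg (z' - z))
  rw [abs_le]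
  constructor
  · have : 0 ≤ ‖z' - z‖ ^ 2 := by positivity
    linarith
  · nlinarith

lemma PM.half (hP : PM f xb lam ε b P) (h : LocPR f xb ρ ε) (hbot : ∀ x, f x ≠ ⊥)
    (hl : 0 < lam) (hlr : lam * ρ = 1 / 2) {z : EuclideanSpace ℝ (Fin n)}
    (hz : z ∈ ball xb b) (hd : DifferentiableAt ℝ P z) (v : EuclideanSpace ℝ (Fin n)) :
    1 / 2 * ‖fderiv ℝ P z v‖ ^ 2 ≤ ⟪fderiv ℝ P z v, v⟫ := by
  have h1 := (hd.hasFDerivAt.hasLineDerivAt v).tendsto_slope_zero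
  have h2 : Tendsto (fun t : ℝ => ⟪t⁻¹ • (P (z + t • v) - P z), v⟫
      - 1 / 2 * ‖t⁻¹ • (P (z + t • v) - P z)‖ ^ 2) (𝓝[≠] 0)
      (𝓝 (⟪fderiv ℝ P z v, v⟫ - 1 / 2 * ‖fderiv ℝ P z v‖ ^ 2)) :=
    (h1.inner tendsto_const_nhds).sub ((h1.norm.pow 2).const_mul _)
  have h3 : ∀ᶠ t : ℝ in 𝓝[≠] 0, z + t • v ∈ ball xb b := by
    have hc : ContinuousAt (fun t : ℝ => z + t • v) 0 := by fun_prop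
    exact (hc.eventually_mem (isOpen_ball.mem_nhds (by simpa using hz))).filter_mono
      nhdsWithin_le_nhds
  have h4 := ge_of_tendsto h2 (b := 0) (by
    filter_upwards [h3, self_mem_nhdsWithin] with t ht ht0
    have ht0' : t ≠ 0 := ht0
    have h5 := hP.mono h hbot hl hlr ht hz
    rw [add_sub_cancel_left, real_inner_smul_right] at h5
    rw [norm_smul, real_inner_smul_left, mul_pow, norm_inv, inv_pow, Real.norm_eq_abs, sq_abs]
    have h6 : 0 ≤ (t ^ 2)⁻¹ := by positivity
    have h7 := mul_le_mul_of_nonneg_left h5 h6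
    have e : (t ^ 2)⁻¹ * (t * ⟪P (z + t • v) - P z, v⟫) = t⁻¹ * ⟪P (z + t • v) - P z, v⟫ := by
      field_simp
    rw [e] at h7
    linarith)
  linarith

lemma PM.normal (hP : PM f xb lam ε b P) (h : LocPR f xb ρ ε) (hbot : ∀ x, f x ≠ ⊥)
    (hl : 0 < lam) (hlr : lam * ρ = 1 / 2) {z : EuclideanSpace ℝ (Fin n)}
    (hz : z ∈ ball xb b) (hd : DifferentiableAt ℝ P z)
    (hsym : ∀ v w, ⟪fderiv ℝ P z v, w⟫ = ⟪v, fderiv ℝ P z w⟫)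
    (h1 : ‖P z - xb‖ < ε) (h2 : ‖lam⁻¹ • (z - P z)‖ < ε)
    (v : EuclideanSpace ℝ (Fin n)) (hv : ‖v‖ = 1) (α : ℝ) (hα : 0 < α)
    (hA : fderiv ℝ P z v = α • v) :
    (((1 - α) / (lam * α)) • v, -v) ∈ FrechetNormalP
          {q : EuclideanSpace ℝ (Fin n) × EuclideanSpace ℝ (Fin n) |
            q.2 ∈ LimitingSubdiff f q.1} (P z, lam⁻¹ • (z - P z)) := by
  intro e he
  have he' : 0 < e * (lam * α) / (1 + lam) := by positivity
  have hlim := hd.hasFDerivAt.isLittleO.def he'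
  obtain ⟨d, hd0, hd1⟩ := Metric.eventually_nhds_iff.1 hlim
  have hzb : ‖z - xb‖ < b := by simpa [dist_eq_norm] using hz
  refine ⟨min (min (d / (1 + lam)) ((b - ‖z - xb‖) / (1 + lam)))
    (min (ε - ‖P z - xb‖) (ε - ‖lam⁻¹ • (z - P z)‖)), ?_, ?_⟩
  · have a1 : 0 < (b - ‖z - xb‖) / (1 + lam) := div_pos (by linarith) (by linarith)
    have a2 : 0 < ε - ‖P z - xb‖ := by linarith
    have a3 : 0 < ε - ‖lam⁻¹ • (z - P z)‖ := by linarith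
    positivity
  rintro ⟨x', p'⟩ hG hdist
  have hG' : p' ∈ LimitingSubdiff f x' := hG
  set p := lam⁻¹ • (z - P z) with hp
  have hzp : z = P z + lam • p := by rw [hp, smul_smul, mul_inv_cancel₀ hl.ne']; simp
  set D := dist (x', p') (P z, p) with hD
  simp only [lt_min_iff] at hdist
  obtain ⟨⟨b1, b2⟩, b3, b4⟩ := hdist
  rw [lt_div_iff₀ (by linarith)] at b1 b2
  have hDx : ‖x' - P z‖ ≤ D := by
    rw [← dist_eq_norm, hD, Prod.dist_eq]; exact le_max_left _ _
  have hDp : ‖p' - p‖ ≤ D := by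
    rw [← dist_eq_norm, hD, Prod.dist_eq]; exact le_max_right _ _
  have ez : (x' + lam • p') - z = (x' - P z) + lam • (p' - p) := by
    nth_rewrite 1 [hzp]; module
  have hDz : ‖(x' + lam • p') - z‖ ≤ D * (1 + lam) := by
    rw [ez]
    refine (norm_add_le _ _).trans ?_
    rw [norm_smul, Real.norm_of_nonneg hl.le]
    nlinarith
  have c1 : ‖x' - xb‖ ≤ ε := by
    have := norm_add_le (x' - P z) (P z - xb)
    rw [sub_add_sub_cancel] at this
    linarith
  have c2 : ‖p'‖ ≤ ε := by
    have := norm_add_le (p' - p) p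
    rw [sub_add_cancel] at this
    linarith
  have c3 : x' + lam • p' ∈ ball xb b := by
    rw [mem_ball, dist_eq_norm]
    have := norm_add_le (x' + lam • p' - z) (z - xb)
    rw [sub_add_sub_cancel] at this
    linarith
  have c4 := hP.uniq h hbot hl hlr hG' c1 c2 c3
  have c5 := hd1 (y := x' + lam • p') (by rw [dist_eq_norm]; linarith)
  rw [c4] at c5
  simp only
  set y := x' - P z - fderiv ℝ P z (x' + lam • p' - z) with hy
  have key : ⟪((1 - α) / (lam * α)) • v, x' - P z⟫ + ⟪-v, p' - p⟫ = (lam * α)⁻¹ * ⟪v, y⟫ := by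
    rw [hy, inner_sub_right v (x' - P z), ← hsym, hA, ez, real_inner_smul_left, inner_neg_left,
      real_inner_smul_left, inner_add_right, real_inner_smul_right]
    field_simp
    ring
  rw [key]
  have c6 : ⟪v, y⟫ ≤ ‖y‖ := by simpa [hv] using real_inner_le_norm v y
  have c7 : ‖y‖ ≤ e * (lam * α) * D := by
    refine c5.trans ?_
    have := mul_le_mul_of_nonneg_left hDz he'.le
    refine this.trans (le_of_eq ?_)
    field_simp
  rw [inv_mul_le_iff₀ (by positivity)]
  nlinarith

end PMsec

lemma line_upper {n : ℕ} (P : EuclideanSpace ℝ (Fin n) → EuclideanSpace ℝ (Fin n))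
    (φ : EuclideanSpace ℝ (Fin n) → ℝ) (xb : EuclideanSpace ℝ (Fin n)) (b s : ℝ)
    (hφ : ∀ z ∈ ball xb b, HasFDerivAt φ (innerSL ℝ (P z)) z)
    (hs : ∀ z ∈ ball xb b, ⟪P z - xb, z - xb⟫ ≤ s * ‖z - xb‖ ^ 2)
    (y : EuclideanSpace ℝ (Fin n)) (hy : y ∈ ball xb b) :
    φ y ≤ φ xb + ⟪xb, y - xb⟫ + s / 2 * ‖y - xb‖ ^ 2 := by
  set v := y - xb with hv
  have hvb : ‖v‖ < b := by simpa [dist_eq_norm] using hy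
  have hmem : ∀ t ∈ Set.Icc (0 : ℝ) 1, xb + t • v ∈ ball xb b := by
    intro t ht
    rw [mem_ball, dist_eq_norm, add_sub_cancel_left, norm_smul, Real.norm_of_nonneg ht.1]
    have := mul_le_mul_of_nonneg_right ht.2 (norm_nonneg v)
    linarith
  let g : ℝ → ℝ := fun t => t * ⟪xb, v⟫ + s / 2 * t ^ 2 * ‖v‖ ^ 2 - φ (xb + t • v)
  have hg : ∀ t ∈ Set.Icc (0 : ℝ) 1,
      HasDerivAt g (⟪xb, v⟫ + s * t * ‖v‖ ^ 2 - ⟪P (xb + t • v), v⟫) t := by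
    intro t ht
    have h1 : HasDerivAt (fun t : ℝ => xb + t • v) v t := by
      simpa using ((hasDerivAt_id t).smul_const v).const_add xb
    have h2 := (hφ _ (hmem t ht)).comp_hasDerivAt t h1
    have h3 : HasDerivAt (fun t : ℝ => t * ⟪xb, v⟫) ⟪xb, v⟫ t := by
      simpa using (hasDerivAt_id t).mul_const ⟪xb, v⟫
    have h4 : HasDerivAt (fun t : ℝ => s / 2 * t ^ 2 * ‖v‖ ^ 2) (s * t * ‖v‖ ^ 2) t := by
      have := ((hasDerivAt_pow 2 t).const_mul (s / 2)).mul_const (‖v‖ ^ 2)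
      refine this.congr_deriv ?_
      push_cast
      ring
    exact (h3.add h4).sub h2
  have hmono : MonotoneOn g (Set.Icc 0 1) := by
    apply monotoneOn_of_deriv_nonneg (convex_Icc 0 1)
    · exact fun t ht => (hg t ht).continuousAt.continuousWithinAt
    · exact fun t ht => (hg t (interior_subset ht)).differentiableAt.differentiableWithinAt
    · intro t ht
      rw [interior_Icc] at ht
      have ht' : t ∈ Set.Icc (0 : ℝ) 1 := ⟨ht.1.le, ht.2.le⟩
      rw [(hg t ht').deriv]
      have h1 := hs _ (hmem t ht')
      rw [add_sub_cancel_left, real_inner_smul_right, inner_sub_left, norm_smul,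
        Real.norm_of_nonneg ht.1.le] at h1
      have h2 : t * (⟪P (xb + t • v), v⟫ - ⟪xb, v⟫) ≤ t * (s * t * ‖v‖ ^ 2) := by
        linarith
      have := le_of_mul_le_mul_left h2 ht.1
      linarith
  have h1 := hmono (by simp) (by simp) (zero_le_one : (0 : ℝ) ≤ 1)
  have e : xb + v = y := by rw [hv]; abel
  simp only [g, zero_smul, one_smul, e, add_zero] at h1
  linarith

set_option maxHeartbeats 1600000 in
lemma part2 {n : ℕ}
    (f : EuclideanSpace ℝ (Fin n) → EReal) (hbot : ∀ x, f x ≠ ⊥) (hlsc : LowerSemicontinuous f)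
    (xb : EuclideanSpace ℝ (Fin n)) (ρ ε : ℝ) (hloc : LocPR f xb ρ ε) (hfin : f xb ≠ ⊤)
    (h0 : (0 : EuclideanSpace ℝ (Fin n)) ∈ LimitingSubdiff f xb)
    (μ r : ℝ) (hμ : 0 < μ) (hr : r < μ⁻¹)
    (H : ∀ u w : EuclideanSpace ℝ (Fin n), w ∈ SecondSubdiff f xb 0 u →
        ‖u‖ ≤ μ * ‖w‖ ∧ -r * ‖u‖ ^ 2 ≤ ⟪w, u⟫) (κ : ℝ) (hκ : μ < κ) :
    TiltStableWith f xb κ := by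
  have hκ0 : 0 < κ := hμ.trans hκ
  have hρ := hloc.1
  have hε := hloc.2.1
  obtain ⟨lam, hl, hlr⟩ : ∃ lam : ℝ, 0 < lam ∧ lam * ρ = 1 / 2 :=
    ⟨1 / (2 * ρ), by positivity, by field_simp⟩
  obtain ⟨δ, hδ, hexcl⟩ := compact_excl f xb ρ μ r hμ hr H κ hκ
  obtain ⟨b₀, hb₀, hPex⟩ := prox_exists f hbot hlsc xb ρ ε hloc hfin h0 lam hl hlr
  choose! P hP₀ using hPex
  obtain ⟨b, hb, hb1, hb2, hb3, hb4, hb5⟩ : ∃ b > 0, b ≤ b₀ ∧ b ≤ δ / 2 ∧ b ≤ δ * lam / 3 ∧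
      b ≤ ε / 2 ∧ b ≤ ε * lam / 3 := by
    refine ⟨min b₀ (min (δ / 2) (min (δ * lam / 3) (min (ε / 2) (ε * lam / 3)))), by positivity,
      ?_, ?_, ?_, ?_, ?_⟩ <;> simp
  have hP : PM f xb lam ε b P := fun z hz => hP₀ z (ball_subset_ball hb1 hz)
  have hxb : xb ∈ ball xb b := mem_ball_self hb
  have hPxb : P xb = xb := by
    have := hP.uniq hloc hbot hl hlr h0 (by simpa using hε.le) (by simpa using hε.le) (by simpa)
    simpa using this
  have hPn : ∀ z ∈ ball xb b, ‖P z - xb‖ < 2 * b ∧ ‖lam⁻¹ • (z - P z)‖ < 3 * b / lam := by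
    intro z hz
    have h1 := hP.lip hloc hbot hl hlr hz hxb
    rw [hPxb] at h1
    rw [mem_ball, dist_eq_norm] at hz
    refine ⟨by linarith, ?_⟩
    rw [norm_smul, norm_inv, Real.norm_of_nonneg hl.le, inv_mul_eq_div]
    have h2 := norm_sub_le (z - xb) (P z - xb)
    rw [sub_sub_sub_cancel_right] at h2
    gcongr
    linarith
  have hsymm : ∀ z ∈ ball xb b, DifferentiableAt ℝ P z → ∀ v w,
      ⟪fderiv ℝ P z v, w⟫ = ⟪v, fderiv ℝ P z w⟫ := fun z hz hd v w =>
    grad_symm P _ xb b (fun z hz => hP.grad hloc hbot hl hlr hz) z hz hd v w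
  set a := 1 + lam / κ with ha
  have ha1 : 1 < a := by have : 0 < lam / κ := by positivity
                         linarith
  have hSM : ∀ z ∈ ball xb b, ∀ z' ∈ ball xb b,
      a * ‖P z' - P z‖ ^ 2 ≤ ⟪P z' - P z, z' - z⟫ := by
    intro z hz z' hz'
    refine integrate_ineq P xb b a 2 (by linarith) ?_ ?_ z z' hz hz'
    · apply LipschitzOnWith.of_dist_le_mul
      intro x hx y hy
      rw [dist_eq_norm, dist_eq_norm]
      exact hP.lip hloc hbot hl hlr hx hy
    · intro z hz hd v
      refine sym_ineq _ (hsymm z hz hd) a ?_ v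
      intro α v hv hA
      by_contra! hc
      have h1 := hP.half hloc hbot hl hlr hz hd v
      rw [hA, norm_smul, real_inner_smul_left, real_inner_self_eq_norm_sq, hv, mul_one,
        Real.norm_eq_abs, sq_abs] at h1
      have hα0 : α ≠ 0 := by rintro rfl; simp at hc
      have hα : 0 < α := lt_of_le_of_ne (by nlinarith [sq_nonneg α]) hα0.symm
      have hα2 : α ≤ 2 := by nlinarith
      obtain ⟨h2, h3⟩ := hPn z hz
      have h3' : 3 * b / lam ≤ ε := by rw [div_le_iff₀ hl]; linarith
      have h3'' : 3 * b / lam ≤ δ := by rw [div_le_iff₀ hl]; linarith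
      refine hexcl (P z) (lam⁻¹ • (z - P z)) (hP z hz).1 ?_ v hv ((1 - α) / (lam * α)) ⟨?_, ?_⟩
        (hP.normal hloc hbot hl hlr hz hd (hsymm z hz hd) (by linarith) (by linarith)
          v hv α hα hA)
      · rw [Prod.dist_eq, max_lt_iff]
        simp only [dist_eq_norm, sub_zero]
        constructor <;> linarith
      · rw [le_div_iff₀ (by positivity)]
        have : -ρ * (lam * α) = - (1 / 2) * α := by rw [← hlr]; ring
        rw [this]; linarith
      · rw [div_le_iff₀ (by positivity)]
        have : α < a * α * α := by linarith [sq α]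
        have h4 : 1 < a * α := by
          by_contra! h5
          nlinarith
        have h6 : κ⁻¹ * (lam * α) = (a - 1) * α := by rw [ha]; field_simp; ring
        rw [h6]; linarith
  have hinn : ∀ z ∈ ball xb b, ⟪P z - xb, z - xb⟫ ≤ a⁻¹ * ‖z - xb‖ ^ 2 := by
    intro z hz
    have h1 := hSM xb hxb z hz
    rw [hPxb] at h1
    have h2 := real_inner_le_norm (P z - xb) (z - xb)
    have h3 : a * ‖P z - xb‖ ≤ ‖z - xb‖ := by
      by_contra! hc
      have h4 : 0 < ‖P z - xb‖ := by
        rcases (norm_nonneg (P z - xb)).eq_or_lt with h5 | h5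
        · rw [← h5, mul_zero] at hc
          exact absurd hc (not_lt.2 (norm_nonneg _))
        · exact h5
      nlinarith
    have h4 : ‖P z - xb‖ ≤ a⁻¹ * ‖z - xb‖ := by
      rw [inv_mul_eq_div, le_div_iff₀ (by linarith)]; linarith
    have := mul_le_mul_of_nonneg_right h4 (norm_nonneg (z - xb))
    nlinarith
  have hainv : a⁻¹ < 1 := inv_lt_one_of_one_lt₀ ha1
  obtain ⟨c, hc, hcdef⟩ : ∃ c : ℝ, 0 < c ∧ lam * c = (1 - a⁻¹) / 2 :=
    ⟨(1 - a⁻¹) / 2 / lam, by have : 0 < 1 - a⁻¹ := by linarith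
                             positivity, by field_simp⟩
  have hgrow : ∀ y ∈ ball xb b, f y ≠ ⊤ →
      (f xb).toReal + c * ‖y - xb‖ ^ 2 ≤ (f y).toReal := by
    intro y hy hyt
    have h1 := line_upper P _ xb b a⁻¹ (fun z hz => hP.grad hloc hbot hl hlr hz) hinn y hy
    obtain ⟨h2, h3, h4⟩ := hP y hy
    have hyb : ‖y - xb‖ < b := by simpa [dist_eq_norm] using hy
    have h5 := hloc.real hbot h2 h3 h4 (x := y) (by linarith) hyt
    rw [real_inner_smul_left, real_inner_self_eq_norm_sq] at h5
    have h6 := mul_le_mul_of_nonneg_left h5 hl.le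
    have e1 : lam * ((f (P y)).toReal + (lam⁻¹ * ‖y - P y‖ ^ 2 - ρ / 2 * ‖y - P y‖ ^ 2))
        = lam * (f (P y)).toReal + 3 / 4 * ‖y - P y‖ ^ 2 := by
      have : lam * (lam⁻¹ * ‖y - P y‖ ^ 2) = ‖y - P y‖ ^ 2 := by field_simp
      linear_combination this - 1 / 2 * ‖y - P y‖ ^ 2 * hlr
    rw [e1] at h6
    simp only [hPxb, sub_self, norm_zero] at h1
    have h7 : 0 ≤ ‖y - P y‖ ^ 2 := by positivity
    have e2 : ‖y‖ ^ 2 = ‖xb‖ ^ 2 + 2 * ⟪xb, y - xb⟫ + ‖y - xb‖ ^ 2 := by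
      rw [← norm_add_sq_real, add_sub_cancel]
    have h8 : lam * ((f xb).toReal + c * ‖y - xb‖ ^ 2) ≤ lam * (f y).toReal := by
      have : lam * ((f xb).toReal + c * ‖y - xb‖ ^ 2)
        = lam * (f xb).toReal + (1 - a⁻¹) / 2 * ‖y - xb‖ ^ 2 := by rw [← hcdef]; ring
      rw [this]
      linarith
    exact le_of_mul_le_mul_left h8 hl
  obtain ⟨η, hη, hη1, hη2, hη3⟩ : ∃ η > 0, η ≤ c * (b / 4) ∧ η ≤ ε ∧ η ≤ b / (2 * lam) := by
    refine ⟨min (c * (b / 4)) (min ε (b / (2 * lam))), by positivity, ?_, ?_, ?_⟩ <;> simp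
  rw [le_div_iff₀ (by positivity)] at hη3
  have hsubball : closedBall xb (b / 4) ⊆ ball xb b := closedBall_subset_ball (by linarith)
  -- structure of tilted minimizers
  have hargr : ∀ p y, y ∈ TiltArgmin f xb (b / 4) p → f y ≠ ⊤ ∧
      ∀ x ∈ closedBall xb (b / 4), f x ≠ ⊤ →
        (f y).toReal - ⟪p, y⟫ ≤ (f x).toReal - ⟪p, x⟫ := by
    intro p y hy
    have hyt : f y ≠ ⊤ := by
      intro htop
      have := hy.2 xb (mem_closedBall_self (by linarith))
      rw [htop, ← EReal.coe_toReal hfin (hbot _), EReal.top_sub_coe, top_le_iff] at this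
      exact EReal.coe_ne_top _ (by exact_mod_cast this)
    refine ⟨hyt, fun x hx hxt => ?_⟩
    have := hy.2 x hx
    rw [← EReal.coe_toReal hxt (hbot _), ← EReal.coe_toReal hyt (hbot _)] at this
    exact_mod_cast this
  have harg : ∀ p ∈ ball (0 : EuclideanSpace ℝ (Fin n)) η, ∀ y ∈ TiltArgmin f xb (b / 4) p,
      y + lam • p ∈ ball xb b ∧ P (y + lam • p) = y := by
    intro p hp y hy
    obtain ⟨hyt, hmin⟩ := hargr p y hy
    have hpn : ‖p‖ < η := by simpa using hp
    have hyn : ‖y - xb‖ ≤ b / 4 := by simpa [dist_eq_norm] using hy.1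
    have h1 := hmin xb (mem_closedBall_self (by linarith)) hfin
    have h2 := hgrow y (hsubball hy.1) hyt
    have h3 := real_inner_le_norm p (y - xb)
    rw [inner_sub_right] at h3
    have h4 : ‖y - xb‖ < b / 4 := by
      by_contra! h5
      have h6 : ‖y - xb‖ = b / 4 := le_antisymm hyn h5
      rw [h6] at h2 h3
      nlinarith
    have hsub : p ∈ LimitingSubdiff f y := by
      apply frechet_sub_limiting
      refine frechet_of_quad (c := 0) (δ := b / 4 - ‖y - xb‖) (by linarith) le_rfl hyt ?_
      intro x hx
      by_cases hxt : f x = ⊤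
      · rw [hxt]; exact le_top
      have hxb' : x ∈ closedBall xb (b / 4) := by
        rw [mem_closedBall, dist_eq_norm]
        have := norm_add_le (x - y) (y - xb)
        rw [sub_add_sub_cancel] at this
        linarith
      have h7 := hmin x hxb' hxt
      rw [← EReal.coe_toReal hxt (hbot _), ← EReal.coe_toReal hyt (hbot _), ← EReal.coe_add,
        EReal.coe_le_coe_iff, inner_sub_right]
      linarith
    have hmem : y + lam • p ∈ ball xb b := by
      rw [mem_ball, dist_eq_norm]
      have h8 : y + lam • p - xb = (y - xb) + lam • p := by abel
      rw [h8]
      have := norm_add_le (y - xb) (lam • p)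
      rw [norm_smul, Real.norm_of_nonneg hl.le] at this
      have h9 : lam * ‖p‖ ≤ lam * η := by gcongr
      linarith
    exact ⟨hmem, hP.uniq hloc hbot hl hlr hsub (by linarith) (by linarith) hmem⟩
  have hLip : ∀ p ∈ ball (0 : EuclideanSpace ℝ (Fin n)) η, ∀ y ∈ TiltArgmin f xb (b / 4) p,
      ∀ p' ∈ ball (0 : EuclideanSpace ℝ (Fin n)) η, ∀ y' ∈ TiltArgmin f xb (b / 4) p',
        ‖y - y'‖ ≤ κ * ‖p - p'‖ := by
    intro p hp y hy p' hp' y' hy'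
    obtain ⟨h1, h2⟩ := harg p hp y hy
    obtain ⟨h1', h2'⟩ := harg p' hp' y' hy'
    have h3 := hSM _ h1' _ h1
    rw [h2, h2'] at h3
    have e : y + lam • p - (y' + lam • p') = (y - y') + lam • (p - p') := by module
    rw [e, inner_add_right, real_inner_self_eq_norm_sq, real_inner_smul_right] at h3
    have h4 := real_inner_le_norm (y - y') (p - p')
    have h5 : lam / κ * ‖y - y'‖ ^ 2 ≤ lam * ⟪y - y', p - p'⟫ := by
      rw [ha] at h3; linarith
    have h6 : ‖y - y'‖ ^ 2 ≤ κ * ⟪y - y', p - p'⟫ := by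
      have := mul_le_mul_of_nonneg_left h5 (by positivity : 0 ≤ κ / lam)
      have e1 : κ / lam * (lam / κ * ‖y - y'‖ ^ 2) = ‖y - y'‖ ^ 2 := by field_simp
      have e2 : κ / lam * (lam * ⟪y - y', p - p'⟫) = κ * ⟪y - y', p - p'⟫ := by field_simp
      rwa [e1, e2] at this
    have h7 := mul_le_mul_of_nonneg_left h4 hκ0.le
    by_contra! hcon
    have h8 : 0 < ‖y - y'‖ := lt_of_le_of_lt (by positivity) hcon
    have h9 : ‖y - y'‖ * ‖y - y'‖ ≤ ‖y - y'‖ * (κ * ‖p - p'‖) := by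
      rw [← sq]; linarith
    exact absurd (le_of_mul_le_mul_left h9 h8) (not_le.2 hcon)
  have hex : ∀ p, ∃ y, y ∈ TiltArgmin f xb (b / 4) p := by
    intro p
    obtain ⟨y, hy, hmin⟩ := exists_min hlsc (fun x => - ⟪p, x⟫) (by fun_prop) xb (b / 4)
      (by linarith)
    refine ⟨y, hy, fun x hx => ?_⟩
    have := hmin x hx
    simpa [sub_eq_add_neg] using this
  choose m hm using hex
  refine ⟨b / 4, by linarith, ball 0 η, ball_mem_nhds _ hη, m, ?_, ?_, ?_⟩
  · intro p hp
    apply Set.eq_singleton_iff_unique_mem.2 ⟨hm p, fun y hy => ?_⟩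
    have := hLip p hp y hy p hp (m p) (hm p)
    rw [sub_self, norm_zero, mul_zero] at this
    exact sub_eq_zero.1 (norm_le_zero_iff.1 this)
  · apply LipschitzOnWith.of_dist_le_mul
    intro p hp p' hp'
    rw [dist_eq_norm, dist_eq_norm, Real.coe_toNNReal _ hκ0.le]
    exact hLip p hp _ (hm p) p' hp' _ (hm p')
  · obtain ⟨h1, h2⟩ := harg 0 (mem_ball_self hη) _ (hm 0)
    obtain ⟨h3, h4⟩ := hargr 0 _ (hm 0)
    have h5 := h4 xb (mem_closedBall_self (by linarith)) hfin
    have h6 := hgrow _ (hsubball (hm 0).1) h3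
    simp only [inner_zero_left, sub_zero] at h5
    have h7 : c * ‖m 0 - xb‖ ^ 2 ≤ 0 := by linarith
    have h8 : ‖m 0 - xb‖ ^ 2 = 0 := le_antisymm (by
      by_contra! h9
      have := mul_pos hc h9
      linarith) (by positivity)
    exact sub_eq_zero.1 (norm_eq_zero.1 (pow_eq_zero_iff two_ne_zero |>.1 h8))

/-- Corollary 4.11: pointwise quantitative characterization of tilt stability
in finite dimensions via the generalized Hessian. -/
theorem pointwise_characterization_of_tilt_stability (n : ℕ)
    (f : EuclideanSpace ℝ (Fin n) → EReal)
    (hproper : ∃ x, f x ≠ ⊤) (hbot : ∀ x, f x ≠ ⊥) (hlsc : LowerSemicontinuous f)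
    (xb : EuclideanSpace ℝ (Fin n))
    (h0 : (0 : EuclideanSpace ℝ (Fin n)) ∈ LimitingSubdiff f xb)
    (hpr : ProxRegularAt f xb 0) (hsc : SubdiffContAt f xb 0) :
    (∀ κ : ℝ, 0 < κ → TiltStableWith f xb κ →
      ∀ r : ℝ, 0 ≤ r → r < κ⁻¹ →
        ∀ u w : EuclideanSpace ℝ (Fin n), w ∈ SecondSubdiff f xb 0 u →
          ‖u‖ ≤ κ * ‖w‖ ∧ -r * ‖u‖ ^ 2 ≤ ⟪w, u⟫) ∧
    (∀ μ r : ℝ, 0 < μ → 0 ≤ r → r < μ⁻¹ →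
      (∀ u w : EuclideanSpace ℝ (Fin n), w ∈ SecondSubdiff f xb 0 u →
        ‖u‖ ≤ μ * ‖w‖ ∧ -r * ‖u‖ ^ 2 ≤ ⟪w, u⟫) →
      ∀ κ : ℝ, μ < κ → TiltStableWith f xb κ) := by
  obtain ⟨ρ, ε, hloc⟩ := locPR_of f xb hbot hpr hsc
  have hfin := hpr.1
  refine ⟨?_, ?_⟩
  · intro κ hκ hts r hr _ u w hw
    obtain ⟨h1, h2⟩ := part1 f hbot xb ρ ε hloc hfin κ hκ hts u w hw
    refine ⟨h1, le_trans ?_ h2⟩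
    have : 0 ≤ r * ‖u‖ ^ 2 := by positivity
    linarith
  · intro μ r hμ _ hr H κ hκ
    exact part2 f hbot hlsc xb ρ ε hloc hfin h0 μ r hμ hr H κ hκ
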